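/- Let P be a finite partial IP loop satisfying condition (4) and such that Γ(P) ≠ ∅. Then there is a finite partial IP loop Q extending P, also satisfying condition (4), such that #Γ(Q) < #Γ(P). -/

import Mathlib

/-- A partial IP loop: a set `carrier` with a partial binary operation defined on
a domain `dom ⊆ carrier ×ˢ carrier` (the value of `mul` is only meaningful on `dom`),
with a unit, unique two-sided inverses, and the inverse property. -/
structure PartialIPLoop (α : Type*) where
  carrier : Set α
  one : α
  dom : Set (α × α)
  mul : α → α → α
  inv : α → α
  one_mem : one ∈ carrier
  dom_subset : dom ⊆ carrier ×ˢ carrier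
  mul_mem : ∀ x y, (x, y) ∈ dom → mul x y ∈ carrier
  one_mul_dom : ∀ x ∈ carrier, (one, x) ∈ dom
  mul_one_dom : ∀ x ∈ carrier, (x, one) ∈ dom
  one_mul : ∀ x ∈ carrier, mul one x = x
  mul_one : ∀ x ∈ carrier, mul x one = x
  inv_mem : ∀ x ∈ carrier, inv x ∈ carrier
  mul_inv_dom : ∀ x ∈ carrier, (x, inv x) ∈ dom
  inv_mul_dom : ∀ x ∈ carrier, (inv x, x) ∈ dom
  mul_inv : ∀ x ∈ carrier, mul x (inv x) = one
  inv_mul : ∀ x ∈ carrier, mul (inv x) x = one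
  inv_unique : ∀ x ∈ carrier, ∀ y ∈ carrier,
    (x, y) ∈ dom → (y, x) ∈ dom → mul x y = one → mul y x = one → y = inv x
  ip_left_dom : ∀ x y, (x, y) ∈ dom → (inv x, mul x y) ∈ dom
  ip_right_dom : ∀ x y, (x, y) ∈ dom → (mul x y, inv y) ∈ dom
  ip_left : ∀ x y, (x, y) ∈ dom → mul (inv x) (mul x y) = y
  ip_right : ∀ x y, (x, y) ∈ dom → mul (mul x y) (inv y) = x

namespace PartialIPLoop

variable {α : Type*}

/-- The set of gaps `Γ(P) = (P × P) \ D(P)`. -/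
def gaps (P : PartialIPLoop α) : Set (α × α) :=
  (P.carrier ×ˢ P.carrier) \ P.dom

/-- The set `O₂(P)` of elements of order two. -/
def O2 (P : PartialIPLoop α) : Set α :=
  {x ∈ P.carrier | x ≠ P.one ∧ (x, x) ∈ P.dom ∧ P.mul x x = P.one}

/-- The set `O₃(P)` of elements of order three. -/
def O3 (P : PartialIPLoop α) : Set α :=
  {x ∈ P.carrier | x ≠ P.one ∧ (x, x) ∈ P.dom ∧ (x, P.mul x x) ∈ P.dom ∧
    P.mul x (P.mul x x) = P.one}

/-- `Q` is an extension of `P`: `P ⊆ Q`, `D(P) ⊆ D(Q)`, and the operations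
agree on `D(P)`. -/
def Ext (P Q : PartialIPLoop α) : Prop :=
  P.carrier ⊆ Q.carrier ∧ P.dom ⊆ Q.dom ∧
    ∀ x y, (x, y) ∈ P.dom → P.mul x y = Q.mul x y

end PartialIPLoop

/-- Condition (4) on a finite partial IP loop `Q`: `3 ∣ o₃(Q)`, `#Q ≥ 10`,
`#Q ≡ 4 (mod 6)` and `Γ(Q) ⊆ O₂(Q) × O₂(Q)`. -/
def Cond4 {α : Type*} (Q : PartialIPLoop α) : Prop :=
  3 ∣ Q.O3.ncard ∧ 10 ≤ Q.carrier.ncard ∧ Q.carrier.ncard % 6 = 4 ∧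
    Q.gaps ⊆ Q.O2 ×ˢ Q.O2

/-- Modulo a prime `p`, a finite set has as many elements as a self-map of order dividing `p`
has fixed points in it. -/
theorem Set.ncard_modEq_ncard_fixed {β : Type*} {S : Set β} (hS : S.Finite) {f : β → β}
    (hf : ∀ x ∈ S, f x ∈ S) (p : ℕ) [Fact p.Prime] (hp : ∀ x ∈ S, f^[p] x = x) :
    S.ncard ≡ {x ∈ S | f x = x}.ncard [MOD p] := by
  classical
  have := hS.fintype
  let g : Function.End S := fun x => ⟨f x, hf x x.2⟩
  have hg : ∀ (n : ℕ) (x : S), (((g ^ n : Function.End S) x : S) : β) = f^[n] x := by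
    intro n
    induction n with
    | zero => intro x; rfl
    | succ n ih =>
      intro x
      rw [pow_succ', Function.iterate_succ_apply', ← ih]
      rfl
  have key := Equiv.Perm.card_fixedPoints_modEq (f := g) (p := p) (n := 1) (by
    funext x
    apply Subtype.ext
    rw [pow_one, hg]
    exact hp x x.2)
  have h1 : Fintype.card S = S.ncard := by rw [← Nat.card_eq_fintype_card]; rfl
  have h2 : Fintype.card (Function.fixedPoints g) = {x ∈ S | f x = x}.ncard := by
    rw [← Nat.card_eq_fintype_card]
    refine Nat.card_congr ⟨fun x => ⟨x.1.1, x.1.2, congrArg Subtype.val x.2⟩,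
      fun x => ⟨⟨x.1, x.2.1⟩, Subtype.ext x.2.2⟩, fun _ => rfl, fun _ => rfl⟩
  rwa [h1, h2] at key

namespace PartialIPLoop

variable {α : Type*} {P Q : PartialIPLoop α} {x y z : α}

theorem inv_inv (hx : x ∈ P.carrier) : P.inv (P.inv x) = x :=
  (P.inv_unique _ (P.inv_mem x hx) x hx (P.inv_mul_dom x hx) (P.mul_inv_dom x hx)
    (P.inv_mul x hx) (P.mul_inv x hx)).symm

theorem inv_one : P.inv P.one = P.one :=
  (P.inv_unique _ P.one_mem _ P.one_mem (P.one_mul_dom _ P.one_mem) (P.one_mul_dom _ P.one_mem)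
    (P.one_mul _ P.one_mem) (P.one_mul _ P.one_mem)).symm

theorem inv_eq_self (hx : x ∈ P.O2) : P.inv x = x :=
  (P.inv_unique _ hx.1 _ hx.1 hx.2.2.1 hx.2.2.1 hx.2.2.2 hx.2.2.2).symm

theorem mem_left (h : (x, y) ∈ P.dom) : x ∈ P.carrier := (P.dom_subset h).1

theorem mem_right (h : (x, y) ∈ P.dom) : y ∈ P.carrier := (P.dom_subset h).2

theorem rotate_mem_dom (h : (x, y) ∈ P.dom) : (y, P.inv (P.mul x y)) ∈ P.dom := by
  simpa only [P.ip_left x y h] using P.ip_right_dom _ _ (P.ip_left_dom x y h)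

theorem mul_rotate (h : (x, y) ∈ P.dom) : P.mul y (P.inv (P.mul x y)) = P.inv x := by
  simpa only [P.ip_left x y h] using P.ip_right _ _ (P.ip_left_dom x y h)

theorem inv_inv_mem_dom (h : (x, y) ∈ P.dom) : (P.inv y, P.inv x) ∈ P.dom := by
  have h1 := P.ip_left_dom _ _ (rotate_mem_dom h)
  rwa [mul_rotate h] at h1

theorem ncard_dom_modEq (hP : P.carrier.Finite) :
    P.dom.ncard ≡ P.O3.ncard + 1 [MOD 3] := by
  have hfin : P.dom.Finite := (hP.prod hP).subset P.dom_subset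
  have key := Set.ncard_modEq_ncard_fixed hfin (f := fun z => (z.2, P.inv (P.mul z.1 z.2)))
    (fun z hz => rotate_mem_dom hz) 3 (by
      rintro ⟨x, y⟩ h
      have hx := mem_left h
      have hy := mem_right h
      have h1 := mul_rotate h
      have h2 := mul_rotate (rotate_mem_dom h)
      rw [h1, inv_inv hx] at h2
      simp only [Function.iterate_succ, Function.iterate_zero, Function.comp, id]
      rw [h1, inv_inv hx, h2, inv_inv hy])
  have hone : P.one ∉ P.O3 := fun h => h.2.1 rfl
  have hO3 : P.O3.Finite := hP.subset fun x hx => hx.1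
  have : {z ∈ P.dom | (z.2, P.inv (P.mul z.1 z.2)) = z}
      = (fun x => (x, x)) '' insert P.one P.O3 := by
    ext ⟨x, y⟩
    simp only [Set.mem_ofPred_eq, Prod.mk.injEq, Set.mem_image, Set.mem_insert_iff]
    constructor
    · rintro ⟨h, rfl, hy⟩
      refine ⟨y, ?_, rfl, rfl⟩
      by_cases h1 : y = P.one
      · exact Or.inl h1
      have hc := mem_left h
      have h2 : P.mul y y = P.inv y := by
        rw [← inv_inv (P.mul_mem _ _ h), hy]
      right
      refine ⟨hc, h1, h, ?_, ?_⟩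
      · rw [h2]; exact P.mul_inv_dom _ hc
      · rw [h2]; exact P.mul_inv _ hc
    · rintro ⟨z, h, rfl, rfl⟩
      rcases h with rfl | ⟨hc, h1, h, h2, h3⟩
      · exact ⟨P.one_mul_dom _ P.one_mem, rfl, by rw [P.one_mul _ P.one_mem, inv_one]⟩
      · refine ⟨h, rfl, ?_⟩
        have h4 := P.ip_left _ _ h2
        have h5 := P.ip_left_dom _ _ h2
        rw [h3] at h4 h5
        rw [P.mul_one _ (P.inv_mem _ hc)] at h4
        rw [← h4, inv_inv hc]
  rw [this, Set.ncard_image_of_injective _ (fun a b h => (Prod.mk.inj h).1),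
    Set.ncard_insert_of_notMem hone hO3] at key
  exact key

theorem gaps_finite (hP : P.carrier.Finite) : P.gaps.Finite :=
  (hP.prod hP).subset Set.sdiff_subset

theorem three_dvd_ncard_gaps (hP : P.carrier.Finite) (h4 : Cond4 P) : 3 ∣ P.gaps.ncard := by
  have hfin : P.dom.Finite := (hP.prod hP).subset P.dom_subset
  have h1 := Set.ncard_sdiff_add_ncard_of_subset P.dom_subset (hP.prod hP)
  rw [Set.ncard_prod] at h1
  obtain ⟨h3, -, h6, -⟩ := h4
  have h2 := ncard_dom_modEq hP
  have h5 : P.carrier.ncard ≡ 1 [MOD 3] := by unfold Nat.ModEq; omega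
  have h7 := h5.mul h5
  change P.gaps.ncard + _ = _ at h1
  rw [← h1] at h7
  unfold Nat.ModEq at h2 h7
  omega

theorem gap_symm (h2 : P.gaps ⊆ P.O2 ×ˢ P.O2) (h : (x, y) ∈ P.gaps) : (y, x) ∈ P.gaps := by
  refine ⟨⟨h.1.2, h.1.1⟩, fun h' => h.2 ?_⟩
  have := inv_inv_mem_dom h'
  rwa [inv_eq_self (h2 h).1, inv_eq_self (h2 h).2] at this

theorem gap_ne (h2 : P.gaps ⊆ P.O2 ×ˢ P.O2) (h : (x, y) ∈ P.gaps) : x ≠ y := by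
  rintro rfl
  exact h.2 (h2 h).1.2.2.1

/-- In a partial IP loop of even order an involution is incident with an even number of gaps. -/
theorem even_ncard_gap_row (hP : P.carrier.Finite) (heven : 2 ∣ P.carrier.ncard)
    (hx : x ∈ P.O2) : 2 ∣ {y | (x, y) ∈ P.gaps}.ncard := by
  have hsub : {y | (x, y) ∈ P.dom} ⊆ P.carrier := fun y hy => mem_right hy
  have key := Set.ncard_modEq_ncard_fixed (hP.subset hsub) (f := fun y => P.mul x y)
    (fun y hy => by
      have := P.ip_left_dom _ _ hy
      rwa [inv_eq_self hx] at this) 2 (by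
      intro y hy
      have := P.ip_left _ _ hy
      rwa [inv_eq_self hx] at this)
  have h0 : {y ∈ {y | (x, y) ∈ P.dom} | P.mul x y = y} = ∅ := by
    ext y
    simp only [Set.mem_ofPred_eq, Set.mem_empty_iff_false, iff_false, not_and]
    intro h h'
    have := P.ip_right _ _ h
    rw [h', P.mul_inv _ (mem_right h)] at this
    exact hx.2.1 this.symm
  rw [h0, Set.ncard_empty] at key
  have h1 := Set.ncard_sdiff_add_ncard_of_subset hsub hP
  have h2 : P.carrier \ {y | (x, y) ∈ P.dom} = {y | (x, y) ∈ P.gaps} := by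
    ext y
    simp [gaps, hx.1]
  rw [h2] at h1
  unfold Nat.ModEq at key
  omega

/-- A set of odd size of neighbours of `x` in the gap graph misses a neighbour of `x`. -/
theorem exists_gap_notMem (hP : P.carrier.Finite) (h4 : Cond4 P) (hx : x ∈ P.O2)
    (F : Finset α) (hF : ∀ y ∈ F, (x, y) ∈ P.gaps) (hodd : F.card % 2 = 1) :
    ∃ y ∉ F, (x, y) ∈ P.gaps := by
  by_contra! h
  have h1 : {y | (x, y) ∈ P.gaps} = (F : Set α) := by
    ext y
    exact ⟨fun hy => by_contra fun h' => h y h' hy, fun hy => hF y hy⟩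
  have h2 := even_ncard_gap_row hP (by have := h4.2.2.1; omega) hx
  rw [h1, Set.ncard_coe_finset] at h2
  omega

theorem Ext.trans {R : PartialIPLoop α} (h : P.Ext Q) (h' : Q.Ext R) : P.Ext R :=
  ⟨h.1.trans h'.1, h.2.1.trans h'.2.1, fun x y hxy =>
    (h.2.2 x y hxy).trans (h'.2.2 x y (h.2.1 hxy))⟩

theorem Ext.one_eq (h : P.Ext Q) : P.one = Q.one := by
  have h1 := P.one_mul_dom _ P.one_mem
  have h2 := Q.ip_left _ _ (h.2.1 h1)
  rw [← h.2.2 _ _ h1, P.one_mul _ P.one_mem, Q.inv_mul _ (h.1 P.one_mem)] at h2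
  exact h2.symm

theorem Ext.O2_subset (h : P.Ext Q) : P.O2 ⊆ Q.O2 := fun x hx =>
  ⟨h.1 hx.1, h.one_eq ▸ hx.2.1, h.2.1 hx.2.2.1,
    by rw [← h.2.2 _ _ hx.2.2.1, hx.2.2.2, h.one_eq]⟩

theorem notMem_O3_of_mem_O2 (hx : x ∈ P.O2) : x ∉ P.O3 := by
  rintro ⟨hc, h1, h, -, h3⟩
  rw [hx.2.2.2, P.mul_one _ hc] at h3
  exact h1 h3

theorem Ext.O3_eq (h : P.Ext Q) (h2 : P.gaps ⊆ P.O2 ×ˢ P.O2)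
    (hnew : Q.carrier \ P.carrier ⊆ Q.O2) : Q.O3 = P.O3 := by
  ext x
  constructor
  · intro hx
    have hxP : x ∈ P.carrier := by_contra fun h' => notMem_O3_of_mem_O2 (hnew ⟨hx.1, h'⟩) hx
    have hdom : ∀ y ∈ P.carrier, (x, y) ∈ P.dom := fun y hy => by_contra fun h' =>
      notMem_O3_of_mem_O2 (h.O2_subset (h2 ⟨⟨hxP, hy⟩, h'⟩).1) hx
    have hm := hdom _ (P.mul_mem _ _ (hdom x hxP))
    refine ⟨hxP, h.one_eq ▸ hx.2.1, hdom x hxP, hm, ?_⟩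
    rw [h.2.2 _ _ hm, h.2.2 _ _ (hdom x hxP), h.one_eq]
    exact hx.2.2.2.2
  · rintro ⟨hc, h1, ha, hb, h3⟩
    refine ⟨h.1 hc, h.one_eq ▸ h1, h.2.1 ha, ?_, ?_⟩
    · rw [← h.2.2 _ _ ha]; exact h.2.1 hb
    · rw [← h.2.2 _ _ ha, ← h.2.2 _ _ hb, h3, h.one_eq]

/-- A functional ternary relation that is closed under the inverse property and contains the
unit and inverse laws is the graph of a partial IP loop. -/
theorem exists_of_rel (C : Set α) (e : α) (i : α → α) (R : α → α → α → Prop)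
    (he : e ∈ C) (hi : ∀ x ∈ C, i x ∈ C)
    (hmem : ∀ x y z, R x y z → x ∈ C ∧ y ∈ C ∧ z ∈ C)
    (hfun : ∀ x y z z', R x y z → R x y z' → z = z')
    (hone : ∀ x ∈ C, R e x x) (hone' : ∀ x ∈ C, R x e x)
    (hinv : ∀ x ∈ C, R x (i x) e) (hinv' : ∀ x ∈ C, R (i x) x e)
    (hleft : ∀ x y z, R x y z → R (i x) z y) (hright : ∀ x y z, R x y z → R z (i y) x) :
    ∃ Q : PartialIPLoop α, Q.carrier = C ∧ Q.one = e ∧ Q.inv = i ∧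
      (∀ x y, (x, y) ∈ Q.dom ↔ ∃ z, R x y z) ∧ ∀ x y z, R x y z → Q.mul x y = z := by
  classical
  let m : α → α → α := fun x y => if h : ∃ z, R x y z then h.choose else x
  have hm : ∀ {x y z}, R x y z → m x y = z := by
    intro x y z h
    have h' : ∃ z, R x y z := ⟨z, h⟩
    simp only [m, dif_pos h']
    exact hfun _ _ _ _ h'.choose_spec h
  refine ⟨{ carrier := C
            one := e
            dom := {w | ∃ z, R w.1 w.2 z}
            mul := m
            inv := i
            one_mem := he
            dom_subset := fun w ⟨z, h⟩ => ⟨(hmem _ _ _ h).1, (hmem _ _ _ h).2.1⟩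
            mul_mem := fun x y ⟨z, h⟩ => by rw [hm h]; exact (hmem _ _ _ h).2.2
            one_mul_dom := fun x hx => ⟨x, hone x hx⟩
            mul_one_dom := fun x hx => ⟨x, hone' x hx⟩
            one_mul := fun x hx => hm (hone x hx)
            mul_one := fun x hx => hm (hone' x hx)
            inv_mem := hi
            mul_inv_dom := fun x hx => ⟨e, hinv x hx⟩
            inv_mul_dom := fun x hx => ⟨e, hinv' x hx⟩
            mul_inv := fun x hx => hm (hinv x hx)
            inv_mul := fun x hx => hm (hinv' x hx)
            inv_unique := fun x hx y hy ⟨z, h⟩ _ h1 _ => by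
              rw [hm h] at h1
              subst h1
              exact hfun _ _ _ _ (hleft _ _ _ h) (hone' _ (hi x hx))
            ip_left_dom := fun x y ⟨z, h⟩ => by rw [hm h]; exact ⟨y, hleft _ _ _ h⟩
            ip_right_dom := fun x y ⟨z, h⟩ => by rw [hm h]; exact ⟨x, hright _ _ _ h⟩
            ip_left := fun x y ⟨z, h⟩ => by rw [hm h]; exact hm (hleft _ _ _ h)
            ip_right := fun x y ⟨z, h⟩ => by rw [hm h]; exact hm (hright _ _ _ h) },
    rfl, rfl, rfl, fun _ _ => Iff.rfl, fun _ _ _ h => hm h⟩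

/-- `x, y, z` are the elements `a, b, c` in some order. -/
def IsArrangement {β : Type*} (a b c x y z : β) : Prop :=
  (x = a ∧ y = b ∧ z = c) ∨ (x = a ∧ y = c ∧ z = b) ∨ (x = b ∧ y = a ∧ z = c) ∨
    (x = b ∧ y = c ∧ z = a) ∨ (x = c ∧ y = a ∧ z = b) ∨ (x = c ∧ y = b ∧ z = a)

theorem IsArrangement.left {β : Type*} {a b c x y z : β} (h : IsArrangement a b c x y z) :
    IsArrangement a b c x z y := by
  unfold IsArrangement at *; tauto

theorem IsArrangement.right {β : Type*} {a b c x y z : β} (h : IsArrangement a b c x y z) :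
    IsArrangement a b c z y x := by
  unfold IsArrangement at *; tauto

/-- Products of involutions can be defined along a family of triangles of gaps, no two of
which share a gap. -/
theorem exists_fill {ι : Type*} (s : Set ι) (a b c : ι → α) (h2 : P.gaps ⊆ P.O2 ×ˢ P.O2)
    (hgap : ∀ i ∈ s, ∀ x y z, IsArrangement (a i) (b i) (c i) x y z → (x, y) ∈ P.gaps)
    (hfun : ∀ i ∈ s, ∀ j ∈ s, ∀ x y z z', IsArrangement (a i) (b i) (c i) x y z →
      IsArrangement (a j) (b j) (c j) x y z' → z = z') :
    ∃ Q : PartialIPLoop α, Q.carrier = P.carrier ∧ P.Ext Q ∧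
      ∀ x y, (x, y) ∈ Q.gaps ↔ (x, y) ∈ P.gaps ∧
        ¬ ∃ i ∈ s, ∃ z, IsArrangement (a i) (b i) (c i) x y z := by
  have hO2 : ∀ i ∈ s, ∀ x y z, IsArrangement (a i) (b i) (c i) x y z → x ∈ P.O2 :=
    fun i hi x y z h => (h2 (hgap i hi _ _ _ h)).1
  obtain ⟨Q, hC, he, hi, hdom, hmul⟩ := exists_of_rel P.carrier P.one P.inv
    (fun x y z => ((x, y) ∈ P.dom ∧ P.mul x y = z) ∨
      ∃ i ∈ s, IsArrangement (a i) (b i) (c i) x y z) P.one_mem P.inv_mem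
    (by
      rintro x y z (⟨h, rfl⟩ | ⟨i, hi, h⟩)
      · exact ⟨mem_left h, mem_right h, P.mul_mem _ _ h⟩
      · exact ⟨(hO2 i hi _ _ _ h).1, (hO2 i hi _ _ _ h.left.right.left).1,
          (hO2 i hi _ _ _ h.right).1⟩)
    (by
      rintro x y z z' (⟨h, rfl⟩ | ⟨i, hi, h⟩) (⟨h', rfl⟩ | ⟨j, hj, h'⟩)
      · rfl
      · exact absurd h (hgap j hj _ _ _ h').2
      · exact absurd h' (hgap i hi _ _ _ h).2
      · exact hfun i hi j hj _ _ _ _ h h')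
    (fun x hx => Or.inl ⟨P.one_mul_dom x hx, P.one_mul x hx⟩)
    (fun x hx => Or.inl ⟨P.mul_one_dom x hx, P.mul_one x hx⟩)
    (fun x hx => Or.inl ⟨P.mul_inv_dom x hx, P.mul_inv x hx⟩)
    (fun x hx => Or.inl ⟨P.inv_mul_dom x hx, P.inv_mul x hx⟩)
    (by
      rintro x y z (⟨h, rfl⟩ | ⟨i, hi, h⟩)
      · exact Or.inl ⟨P.ip_left_dom _ _ h, P.ip_left _ _ h⟩
      · rw [inv_eq_self (hO2 i hi _ _ _ h)]
        exact Or.inr ⟨i, hi, h.left⟩)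
    (by
      rintro x y z (⟨h, rfl⟩ | ⟨i, hi, h⟩)
      · exact Or.inl ⟨P.ip_right_dom _ _ h, P.ip_right _ _ h⟩
      · rw [inv_eq_self (hO2 i hi _ _ _ h.left.right.left)]
        exact Or.inr ⟨i, hi, h.right⟩)
  refine ⟨Q, hC, ⟨hC.ge, fun z hz => (hdom _ _).2 ⟨_, Or.inl ⟨hz, rfl⟩⟩,
    fun x y h => (hmul _ _ _ (Or.inl ⟨h, rfl⟩)).symm⟩, fun x y => ?_⟩
  simp only [gaps, Set.mem_sdiff, hC, hdom, exists_or, not_or, exists_and_left, exists_eq',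
    and_true, and_assoc]
  rw [exists_comm]
  simp only [exists_and_left]

/-- The data needed to adjoin a set `T` of involutions to `P`: the value `δ v w` is the product
of `v, w : T`, which lies either in `P` or in `T`. -/
structure IsLink {T : Type*} (P : PartialIPLoop α) (δ : T → T → α ⊕ T) : Prop where
  mem : ∀ v w p, δ v w = Sum.inl p → p ∈ P.carrier
  self : ∀ v, δ v v = Sum.inl P.one
  inj : ∀ v w w' p, δ v w = Sum.inl p → δ v w' = Sum.inl p → w = w'
  inv : ∀ v w p, δ v w = Sum.inl p → δ w v = Sum.inl (P.inv p)
  swap : ∀ v w u, δ v w = Sum.inr u → δ w v = Sum.inr u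
  tri : ∀ v w u, δ v w = Sum.inr u → δ v u = Sum.inr w

theorem exists_glue {T : Type*} {δ : T → T → α ⊕ T} (hδ : P.IsLink δ) (e : T → α)
    (he : Function.Injective e) (hP : ∀ v, e v ∉ P.carrier) :
    ∃ Q : PartialIPLoop α, Q.carrier = P.carrier ∪ Set.range e ∧ P.Ext Q ∧
      (∀ v, e v ∈ Q.O2) ∧ ∀ x y, (x, y) ∈ Q.gaps ↔ (x, y) ∈ P.gaps ∨
        (∃ v, x = e v ∧ y ∈ P.carrier ∧ ∀ w, δ v w ≠ Sum.inl y) ∨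
        (∃ v, y = e v ∧ x ∈ P.carrier ∧ ∀ w, δ w v ≠ Sum.inl x) := by
  classical
  have hinj' : ∀ v v' w p, δ v w = Sum.inl p → δ v' w = Sum.inl p → v = v' :=
    fun v v' w p h h' => hδ.inj _ _ _ _ (hδ.inv _ _ _ h) (hδ.inv _ _ _ h')
  have hie : ∀ v, (if e v ∈ P.carrier then P.inv (e v) else e v) = e v :=
    fun v => if_neg (hP v)
  obtain ⟨Q, hC, hQ1, hi, hdom, hmul⟩ := exists_of_rel (P.carrier ∪ Set.range e) P.one
    (fun x => if x ∈ P.carrier then P.inv x else x)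
    (fun x y z => ((x, y) ∈ P.dom ∧ P.mul x y = z) ∨
      (∃ v w, x = e v ∧ y = e w ∧ Sum.elim id e (δ v w) = z) ∨
      (∃ v w p, δ v w = Sum.inl p ∧ x = e v ∧ y = p ∧ z = e w) ∨
      (∃ v w p, δ v w = Sum.inl p ∧ x = p ∧ y = e w ∧ z = e v))
    (Or.inl P.one_mem)
    (by
      rintro x (hx | ⟨v, rfl⟩)
      · rw [if_pos hx]
        exact Or.inl (P.inv_mem x hx)
      · rw [hie]
        exact Or.inr ⟨v, rfl⟩)
    (by
      rintro x y z (⟨h, rfl⟩ | ⟨v, w, rfl, rfl, rfl⟩ | ⟨v, w, p, h, rfl, rfl, rfl⟩ |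
        ⟨v, w, p, h, rfl, rfl, rfl⟩)
      · exact ⟨Or.inl (mem_left h), Or.inl (mem_right h), Or.inl (P.mul_mem _ _ h)⟩
      · refine ⟨Or.inr ⟨v, rfl⟩, Or.inr ⟨w, rfl⟩, ?_⟩
        rcases h : δ v w with p | u
        · exact Or.inl (hδ.mem _ _ _ h)
        · exact Or.inr ⟨u, rfl⟩
      · exact ⟨Or.inr ⟨v, rfl⟩, Or.inl (hδ.mem _ _ _ h), Or.inr ⟨w, rfl⟩⟩
      · exact ⟨Or.inl (hδ.mem _ _ _ h), Or.inr ⟨w, rfl⟩, Or.inr ⟨v, rfl⟩⟩)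
    (by
      rintro x y z z' (⟨h, rfl⟩ | ⟨v, w, rfl, rfl, rfl⟩ | ⟨v, w, p, h, rfl, rfl, rfl⟩ |
          ⟨v, w, p, h, rfl, rfl, rfl⟩) (⟨h', rfl⟩ | ⟨v', w', h1, h2, rfl⟩ |
          ⟨v', w', p', h', h1, h2, rfl⟩ | ⟨v', w', p', h', h1, h2, rfl⟩)
      · rfl
      · exact absurd (h1 ▸ mem_left h) (hP v')
      · exact absurd (h1 ▸ mem_left h) (hP v')
      · exact absurd (h2 ▸ mem_right h) (hP w')
      · exact absurd (mem_left h') (hP v)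
      · rw [he h1, he h2]
      · exact absurd (h2 ▸ hδ.mem _ _ _ h') (hP w)
      · exact absurd (h1 ▸ hδ.mem _ _ _ h') (hP v)
      · exact absurd (mem_left h') (hP v)
      · exact absurd (h2 ▸ hδ.mem _ _ _ h) (hP w')
      · rw [hδ.inj v w w' y h (by rw [he h1, h2]; exact h')]
      · exact absurd (h1 ▸ hδ.mem _ _ _ h') (hP v)
      · exact absurd (mem_right h') (hP w)
      · exact absurd (h1 ▸ hδ.mem _ _ _ h) (hP v')
      · exact absurd (h1 ▸ hδ.mem _ _ _ h) (hP v')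
      · rw [hinj' v v' w x h (by rw [he h2, h1]; exact h')])
    (by
      rintro x (hx | ⟨v, rfl⟩)
      · exact Or.inl ⟨P.one_mul_dom x hx, P.one_mul x hx⟩
      · exact Or.inr (Or.inr (Or.inr ⟨v, v, _, hδ.self v, rfl, rfl, rfl⟩)))
    (by
      rintro x (hx | ⟨v, rfl⟩)
      · exact Or.inl ⟨P.mul_one_dom x hx, P.mul_one x hx⟩
      · exact Or.inr (Or.inr (Or.inl ⟨v, v, _, hδ.self v, rfl, rfl, rfl⟩)))
    (by
      rintro x (hx | ⟨v, rfl⟩)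
      · simp only [if_pos hx]
        exact Or.inl ⟨P.mul_inv_dom x hx, P.mul_inv x hx⟩
      · simp only [hie]
        exact Or.inr (Or.inl ⟨v, v, rfl, rfl, by rw [hδ.self]; rfl⟩))
    (by
      rintro x (hx | ⟨v, rfl⟩)
      · simp only [if_pos hx]
        exact Or.inl ⟨P.inv_mul_dom x hx, P.inv_mul x hx⟩
      · simp only [hie]
        exact Or.inr (Or.inl ⟨v, v, rfl, rfl, by rw [hδ.self]; rfl⟩))
    (by
      rintro x y z (⟨h, rfl⟩ | ⟨v, w, rfl, rfl, rfl⟩ | ⟨v, w, p, h, rfl, rfl, rfl⟩ |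
        ⟨v, w, p, h, rfl, rfl, rfl⟩)
      · rw [if_pos (mem_left h)]
        exact Or.inl ⟨P.ip_left_dom _ _ h, P.ip_left _ _ h⟩
      · rw [hie]
        rcases h : δ v w with p | u
        · exact Or.inr (Or.inr (Or.inl ⟨v, w, p, h, rfl, rfl, rfl⟩))
        · exact Or.inr (Or.inl ⟨v, u, rfl, rfl, by rw [hδ.tri _ _ _ h]; rfl⟩)
      · rw [hie]
        exact Or.inr (Or.inl ⟨v, w, rfl, rfl, by rw [h]; rfl⟩)
      · rw [if_pos (hδ.mem _ _ _ h)]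
        exact Or.inr (Or.inr (Or.inr ⟨w, v, _, hδ.inv _ _ _ h, rfl, rfl, rfl⟩)))
    (by
      rintro x y z (⟨h, rfl⟩ | ⟨v, w, rfl, rfl, rfl⟩ | ⟨v, w, p, h, rfl, rfl, rfl⟩ |
        ⟨v, w, p, h, rfl, rfl, rfl⟩)
      · rw [if_pos (mem_right h)]
        exact Or.inl ⟨P.ip_right_dom _ _ h, P.ip_right _ _ h⟩
      · rw [hie]
        rcases h : δ v w with p | u
        · exact Or.inr (Or.inr (Or.inr ⟨v, w, p, h, rfl, rfl, rfl⟩))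
        · refine Or.inr (Or.inl ⟨u, w, rfl, rfl, ?_⟩)
          rw [hδ.swap _ _ _ (hδ.tri _ _ _ (hδ.swap _ _ _ h))]; rfl
      · rw [if_pos (hδ.mem _ _ _ h)]
        exact Or.inr (Or.inr (Or.inl ⟨w, v, _, hδ.inv _ _ _ h, rfl, rfl, rfl⟩))
      · rw [hie]
        exact Or.inr (Or.inl ⟨v, w, rfl, rfl, by rw [h]; rfl⟩))
  have hsq : ∀ v, (e v, e v) ∈ Q.dom ∧ Q.mul (e v) (e v) = P.one := fun v => by
    have := hδ.self v
    exact ⟨(hdom _ _).2 ⟨P.one, Or.inr (Or.inl ⟨v, v, rfl, rfl, by rw [this]; rfl⟩)⟩,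
      hmul _ _ _ (Or.inr (Or.inl ⟨v, v, rfl, rfl, by rw [this]; rfl⟩))⟩
  refine ⟨Q, hC, ⟨hC ▸ Set.subset_union_left, fun z hz => (hdom _ _).2 ⟨_, Or.inl ⟨hz, rfl⟩⟩,
    fun x y h => (hmul _ _ _ (Or.inl ⟨h, rfl⟩)).symm⟩, fun v => ⟨hC ▸ Or.inr ⟨v, rfl⟩, ?_,
    (hsq v).1, ?_⟩, fun x y => ?_⟩
  · rw [hQ1]
    exact fun h => hP v (h ▸ P.one_mem)
  · rw [hQ1]
    exact (hsq v).2
  · have hmemgap : (x, y) ∈ Q.gaps ↔ (x ∈ P.carrier ∪ Set.range e ∧ y ∈ P.carrier ∪ Set.range e)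
        ∧ (x, y) ∉ Q.dom := by
      rw [← hC]; exact Iff.rfl
    rw [hmemgap, hdom]
    constructor
    · rintro ⟨⟨hx | ⟨v, rfl⟩, hy | ⟨w, rfl⟩⟩, h⟩
      · exact Or.inl ⟨⟨hx, hy⟩, fun h' => h ⟨_, Or.inl ⟨h', rfl⟩⟩⟩
      · exact Or.inr (Or.inr ⟨w, rfl, hx, fun v h' =>
          h ⟨e v, Or.inr (Or.inr (Or.inr ⟨v, w, _, h', rfl, rfl, rfl⟩))⟩⟩)
      · exact Or.inr (Or.inl ⟨v, rfl, hy, fun w h' =>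
          h ⟨e w, Or.inr (Or.inr (Or.inl ⟨v, w, _, h', rfl, rfl, rfl⟩))⟩⟩)
      · exact absurd ⟨_, Or.inr (Or.inl ⟨v, w, rfl, rfl, rfl⟩)⟩ h
    · rintro (⟨⟨hx, hy⟩, h⟩ | ⟨v, rfl, hy, h⟩ | ⟨v, rfl, hx, h⟩)
      · refine ⟨⟨Or.inl hx, Or.inl hy⟩, ?_⟩
        rintro ⟨z, ⟨h', rfl⟩ | ⟨v, w, rfl, rfl, rfl⟩ | ⟨v, w, p, h', rfl, rfl, rfl⟩ |
          ⟨v, w, p, h', rfl, rfl, rfl⟩⟩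
        · exact h h'
        · exact hP _ hx
        · exact hP _ hx
        · exact hP _ hy
      · refine ⟨⟨Or.inr ⟨v, rfl⟩, Or.inl hy⟩, ?_⟩
        rintro ⟨z, ⟨h', rfl⟩ | ⟨v', w, h1, rfl, rfl⟩ | ⟨v', w, p, h', h1, rfl, rfl⟩ |
          ⟨v', w, p, h', h1, rfl, rfl⟩⟩
        · exact hP _ (mem_left h')
        · exact hP _ hy
        · exact h w (by rw [he h1]; exact h')
        · exact hP _ hy
      · refine ⟨⟨Or.inl hx, Or.inr ⟨v, rfl⟩⟩, ?_⟩
        rintro ⟨z, ⟨h', rfl⟩ | ⟨v', w, rfl, h1, rfl⟩ | ⟨v', w, p, h', rfl, h1, rfl⟩ |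
          ⟨v', w, p, h', h1, h2, rfl⟩⟩
        · exact hP _ (mem_right h')
        · exact hP _ hx
        · exact hP _ hx
        · exact h v' (by rw [he h2, h1]; exact h')

/-- The product of distinct elements in Bose's Steiner triple system on `ZMod 3 × ZMod q`, for
odd `q`; here `h` is the inverse of `2` in `ZMod q`. -/
def bose {q : ℕ} (h : ZMod q) (x y : ZMod 3 × ZMod q) : ZMod 3 × ZMod q :=
  if x.1 = y.1 then (x.1 + 1, h * (x.2 + y.2))
  else if x.2 = y.2 then (-x.1 - y.1, x.2)
  else if x.1 = y.1 + 1 then (y.1, 2 * x.2 - y.2)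
  else (x.1, 2 * y.2 - x.2)

theorem zmod_three_cases (i j : ZMod 3) : i = j ∨ j = i + 1 ∨ i = j + 1 := by
  revert i j; decide

theorem bose_comm {q : ℕ} (h : ZMod q) (x y : ZMod 3 × ZMod q) : bose h x y = bose h y x := by
  obtain ⟨i, x⟩ := x
  obtain ⟨j, y⟩ := y
  have h1 : ∀ i : ZMod 3, i ≠ i + 1 := by decide
  have h2 : ∀ i : ZMod 3, i ≠ i + 1 + 1 := by decide
  rcases zmod_three_cases i j with rfl | rfl | rfl
  · simp [bose, add_comm]
  all_goals
    by_cases hxy : x = y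
    · subst hxy
      simp [bose, (h1 _).symm, sub_eq_add_neg, add_comm]
    · simp [bose, h1, (h1 _).symm, h2, hxy, Ne.symm hxy]

theorem bose_bose {q : ℕ} {h : ZMod q} (hh : 2 * h = 1) {x y : ZMod 3 × ZMod q} (hxy : x ≠ y) :
    bose h x (bose h x y) = y := by
  obtain ⟨i, x⟩ := x
  obtain ⟨j, y⟩ := y
  have h1 : ∀ i : ZMod 3, i ≠ i + 1 := by decide
  have h2 : ∀ i : ZMod 3, i ≠ i + 1 + 1 := by decide
  have h3 : ∀ i : ZMod 3, i ≠ -i - (i + 1) := by decide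
  have h4 : ∀ j : ZMod 3, j + 1 ≠ -(j + 1) - j := by decide
  rcases zmod_three_cases i j with rfl | rfl | rfl
  · have hne : x ≠ y := fun h' => hxy (by rw [h'])
    have hm : x ≠ h * (x + y) := fun h' => hne (by linear_combination 2 * h' + (x + y) * hh)
    simp only [bose, h1, h2, hm, if_true, if_false, Prod.mk.injEq, true_and]
    linear_combination (x + y) * hh
  · by_cases hxy : x = y
    · subst hxy
      simp only [bose, h1, h3, if_true, if_false, Prod.mk.injEq, and_true]
      ring
    · simp only [bose, h1, h2, hxy, if_true, if_false, Prod.mk.injEq, true_and]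
      linear_combination y * hh
  · by_cases hxy : x = y
    · subst hxy
      simp only [bose, (h1 _).symm, h4, if_true, if_false, Prod.mk.injEq, and_true]
      ring
    · have hm : x ≠ 2 * x - y := fun h' => hxy (by linear_combination -h')
      simp [bose, (h1 _).symm, hxy, hm]

theorem ne_bose {q : ℕ} {h : ZMod q} (hh : 2 * h = 1) {x y : ZMod 3 × ZMod q} (hxy : x ≠ y) :
    x ≠ bose h x y := by
  obtain ⟨i, x⟩ := x
  obtain ⟨j, y⟩ := y
  have h1 : ∀ i : ZMod 3, i ≠ i + 1 := by decide
  have h2 : ∀ i : ZMod 3, i ≠ i + 1 + 1 := by decide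
  have h3 : ∀ i : ZMod 3, i ≠ -i - (i + 1) := by decide
  have h4 : ∀ j : ZMod 3, j + 1 ≠ -(j + 1) - j := by decide
  rcases zmod_three_cases i j with rfl | rfl | rfl
  · simp [bose]
  · by_cases hxy : x = y
    · simp only [bose, h1, hxy, if_true, if_false, ne_eq, Prod.mk.injEq, h3, false_and,
        not_false_eq_true]
    · have hm : x ≠ 2 * y - x := fun h' => hxy (by linear_combination h * h' + (y - x) * hh)
      simp [bose, h1, h2, hxy, hm]
  · by_cases hxy : x = y
    · simp only [bose, (h1 _).symm, hxy, if_true, if_false, ne_eq, Prod.mk.injEq, h4, false_and,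
        not_false_eq_true]
    · simp [bose, (h1 _).symm, hxy]

/-- The two-layered product on `Bool × (ZMod 3 × ZMod q)`: a Steiner triple system on each layer,
and a Latin square labelled by `g` between the layers. -/
def layers {q : ℕ} (P : PartialIPLoop α) (h : ZMod q) (g : ZMod 3 × ZMod q → α) :
    Bool × ZMod 3 × ZMod q → Bool × ZMod 3 × ZMod q → α ⊕ (Bool × ZMod 3 × ZMod q)
  | (false, x), (true, y) => Sum.inl (g (y - x))
  | (true, x), (false, y) => Sum.inl (P.inv (g (x - y)))
  | (false, x), (false, y) => if x = y then Sum.inl P.one else Sum.inr (false, bose h x y)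
  | (true, x), (true, y) => if x = y then Sum.inl P.one else Sum.inr (true, bose h x y)

theorem isLink_layers {q : ℕ} {h : ZMod q} (hh : 2 * h = 1) {g : ZMod 3 × ZMod q → α}
    (hg : Function.Injective g) (hgP : ∀ b, g b ∈ P.carrier) (hg1 : ∀ b, g b ≠ P.one) :
    P.IsLink (layers P h g) := by
  have hinv : ∀ {b c}, P.inv (g b) = P.inv (g c) → b = c := fun {b c} h' =>
    hg (by rw [← inv_inv (hgP b), h', inv_inv (hgP c)])
  have hi1 : ∀ b, P.inv (g b) ≠ P.one := fun b h' =>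
    hg1 b (by rw [← inv_inv (hgP b), h', inv_one])
  have hi1' : ∀ b, P.one ≠ P.inv (g b) := fun b => (hi1 b).symm
  have hg1' : ∀ b, P.one ≠ g b := fun b => (hg1 b).symm
  have bb := @bose_bose q h hh
  have nb := @ne_bose q h hh
  have bc := @bose_comm q h
  have hone := inv_one (P := P)
  constructor
  · rintro ⟨_ | _, x⟩ ⟨_ | _, y⟩ p h' <;> simp only [layers] at h'
    · split_ifs at h'; cases h'; exact P.one_mem
    · cases h'; exact hgP _
    · cases h'; exact P.inv_mem _ (hgP _)
    · split_ifs at h'; cases h'; exact P.one_mem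
  · rintro ⟨_ | _, x⟩ <;> simp [layers]
  · rintro ⟨_ | _, x⟩ ⟨_ | _, y⟩ ⟨_ | _, z⟩ p h1 h2 <;> simp only [layers] at h1 h2 <;>
      grind
  · rintro ⟨_ | _, x⟩ ⟨_ | _, y⟩ p h1 <;> simp only [layers] at h1 ⊢
    · grind
    · grind
    · have := inv_inv (hgP (x - y)); grind
    · grind
  · rintro ⟨_ | _, x⟩ ⟨_ | _, y⟩ ⟨_ | _, z⟩ h1 <;> simp only [layers] at h1 ⊢ <;> grind
  · rintro ⟨_ | _, x⟩ ⟨_ | _, y⟩ ⟨_ | _, z⟩ h1 <;> simp only [layers] at h1 ⊢ <;> grind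

theorem layers_surj {q : ℕ} {h : ZMod q} {g : ZMod 3 × ZMod q → α}
    (hs : ∀ p ∈ P.carrier, p ≠ P.one → ∃ b, g b = p) (v : Bool × ZMod 3 × ZMod q)
    {p : α} (hp : p ∈ P.carrier) : ∃ w, layers P h g v w = Sum.inl p := by
  by_cases h1 : p = P.one
  · subst h1
    exact ⟨v, by obtain ⟨_ | _, x⟩ := v <;> simp [layers]⟩
  · obtain ⟨_ | _, x⟩ := v
    · obtain ⟨b, rfl⟩ := hs p hp h1
      exact ⟨(true, x + b), by simp [layers]⟩
    · obtain ⟨b, hb⟩ := hs (P.inv p) (P.inv_mem p hp)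
        fun h' => h1 (by rw [← inv_inv hp, h', inv_one])
      exact ⟨(false, x - b), by simp [layers, hb, inv_inv hp]⟩

/-- The third vertex of the triangle containing two given vertices, for the triangles
`{0, 1, 2}`, `{2, 3, 4}` and `{4, 5, 0}` on the vertices of a hexagon. -/
def hexThird : Fin 6 → Fin 6 → Option (Fin 6) :=
  ![![none, some 2, some 1, none, some 5, some 4],
    ![some 2, none, some 0, none, none, none],
    ![some 1, some 0, none, some 4, some 3, none],
    ![none, none, some 4, none, some 2, none],
    ![some 5, none, some 3, some 2, none, some 0],
    ![some 4, none, none, none, some 0, none]]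

theorem hexThird_swap : ∀ i j k, hexThird i j = some k → hexThird j i = some k := by decide

theorem hexThird_tri : ∀ i j k, hexThird i j = some k → hexThird i k = some j := by decide

theorem hexThird_self : ∀ i k, hexThird i i ≠ some k := by decide

theorem hexThird_succ : ∀ i, ∃ k, hexThird i (i + 1) = some k := by decide

theorem hexThird_cases : ∀ i j k, hexThird i j = some k → j = i + 1 ∨ i = j + 1 ∨
    (i = 0 ∧ j = 2 ∨ i = 0 ∧ j = 4 ∨ i = 2 ∧ j = 0 ∨ i = 2 ∧ j = 4 ∨ i = 4 ∧ j = 0 ∨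
      i = 4 ∧ j = 2) := by decide

/-- In a link, a hexagon `u` of crossing pairs whose even vertices form a triangle can be replaced
by three triangles, which frees the labels of the sides of the hexagon. -/
theorem IsLink.exists_trade {T : Type*} {δ : T → T → α ⊕ T} (hδ : P.IsLink δ)
    (hs : ∀ v, ∀ p ∈ P.carrier, ∃ w, δ v w = Sum.inl p) {u : Fin 6 → T}
    (hu : Function.Injective u) {a : Fin 6 → α} (ha : ∀ i, P.inv (a i) = a i)
    (hcell : ∀ i, δ (u i) (u (i + 1)) = Sum.inl (a (i + 1)))
    (htri : δ (u 0) (u 2) = Sum.inr (u 4)) :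
    ∃ δ' : T → T → α ⊕ T, P.IsLink δ' ∧ ∀ v, ∀ p ∈ P.carrier,
      (∀ w, δ' v w ≠ Sum.inl p) ↔ ∃ i, v = u i ∧ (p = a i ∨ p = a (i + 1)) := by
  classical
  let Tri : T → T → T → Prop := fun v w z =>
    ∃ i j k, v = u i ∧ w = u j ∧ z = u k ∧ hexThird i j = some k
  have tri_swap : ∀ {v w z}, Tri v w z → Tri w v z := by
    rintro _ _ _ ⟨i, j, k, rfl, rfl, rfl, h⟩
    exact ⟨j, i, k, rfl, rfl, rfl, hexThird_swap _ _ _ h⟩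
  have tri_tri : ∀ {v w z}, Tri v w z → Tri v z w := by
    rintro _ _ _ ⟨i, j, k, rfl, rfl, rfl, h⟩
    exact ⟨i, k, j, rfl, rfl, rfl, hexThird_tri _ _ _ h⟩
  have tri_fun : ∀ {v w z z'}, Tri v w z → Tri v w z' → z = z' := by
    rintro _ _ _ _ ⟨i, j, k, rfl, rfl, rfl, h⟩ ⟨i', j', k', h1, h2, rfl, h'⟩
    rw [hu h1, hu h2, h'] at h
    rw [Option.some.inj h]
  have hcell' : ∀ i, δ (u (i + 1)) (u i) = Sum.inl (a (i + 1)) := fun i => by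
    rw [hδ.inv _ _ _ (hcell i), ha]
  have h04 := hδ.tri _ _ _ htri
  have h20 := hδ.swap _ _ _ htri
  have h40 := hδ.swap _ _ _ h04
  have h24 := hδ.tri _ _ _ h20
  have h42 := hδ.swap _ _ _ h24
  have even : ∀ {i j z}, (i = 0 ∧ j = 2 ∨ i = 0 ∧ j = 4 ∨ i = 2 ∧ j = 0 ∨ i = 2 ∧ j = 4 ∨
      i = 4 ∧ j = 0 ∨ i = 4 ∧ j = 2) → δ (u i) (u j) = z → ∃ t, z = Sum.inr t ∧
      ∃ s, Tri (u i) t s := by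
    rintro i j z (⟨rfl, rfl⟩ | ⟨rfl, rfl⟩ | ⟨rfl, rfl⟩ | ⟨rfl, rfl⟩ | ⟨rfl, rfl⟩ | ⟨rfl, rfl⟩) h
    · exact ⟨u 4, by rw [← h, htri], u 5, 0, 4, 5, rfl, rfl, rfl, rfl⟩
    · exact ⟨u 2, by rw [← h, h04], u 1, 0, 2, 1, rfl, rfl, rfl, rfl⟩
    · exact ⟨u 4, by rw [← h, h20], u 3, 2, 4, 3, rfl, rfl, rfl, rfl⟩
    · exact ⟨u 0, by rw [← h, h24], u 1, 2, 0, 1, rfl, rfl, rfl, rfl⟩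
    · exact ⟨u 2, by rw [← h, h40], u 3, 4, 2, 3, rfl, rfl, rfl, rfl⟩
    · exact ⟨u 0, by rw [← h, h42], u 5, 4, 0, 5, rfl, rfl, rfl, rfl⟩
  let δ' : T → T → α ⊕ T := fun v w => if h : ∃ z, Tri v w z then Sum.inr h.choose else δ v w
  have e1 : ∀ {v w z}, Tri v w z → δ' v w = Sum.inr z := fun {v w z} h => by
    have h' : ∃ z, Tri v w z := ⟨z, h⟩
    simp only [δ', dif_pos h']
    rw [tri_fun h h'.choose_spec]
  have e2 : ∀ {v w}, (¬ ∃ z, Tri v w z) → δ' v w = δ v w := fun h => dif_neg h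
  have inl_of : ∀ {v w p}, δ' v w = Sum.inl p → (¬ ∃ z, Tri v w z) ∧ δ v w = Sum.inl p := by
    intro v w p h
    by_cases h' : ∃ z, Tri v w z
    · obtain ⟨z, hz⟩ := h'
      rw [e1 hz] at h
      cases h
    · exact ⟨h', by rw [← e2 h', h]⟩
  refine ⟨δ', ⟨fun v w p h => hδ.mem _ _ _ (inl_of h).2, fun v => ?_,
    fun v w w' p h h' => hδ.inj _ _ _ _ (inl_of h).2 (inl_of h').2, fun v w p h => ?_,
    fun v w z h => ?_, fun v w z h => ?_⟩, fun v p hp => ⟨fun h => ?_, ?_⟩⟩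
  · rw [e2, hδ.self]
    rintro ⟨_, i, j, k, rfl, h2, rfl, h⟩
    exact hexThird_self _ _ (hu h2 ▸ h)
  · rw [e2 fun ⟨z, hz⟩ => (inl_of h).1 ⟨z, tri_swap hz⟩]
    exact hδ.inv _ _ _ (inl_of h).2
  · by_cases h' : ∃ z, Tri v w z
    · obtain ⟨z', hz⟩ := h'
      rw [e1 (tri_swap hz), ← h, e1 hz]
    · rw [e2 h'] at h
      rw [e2 fun ⟨z, hz⟩ => h' ⟨z, tri_swap hz⟩]
      exact hδ.swap _ _ _ h
  · by_cases h' : ∃ z, Tri v w z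
    · obtain ⟨z', hz⟩ := h'
      rw [e1 hz] at h
      cases h
      exact e1 (tri_tri hz)
    · rw [e2 h'] at h
      have h3 := hδ.tri _ _ _ h
      rw [e2, h3]
      rintro ⟨_, i, j, k, rfl, rfl, rfl, ht⟩
      rcases hexThird_cases _ _ _ ht with rfl | rfl | hij
      · rw [hcell] at h3; cases h3
      · rw [hcell'] at h3; cases h3
      · obtain ⟨t, ht, hs⟩ := even hij h3
        cases ht
        exact h' hs
  · obtain ⟨w, hw⟩ := hs v p hp
    by_cases h' : ∃ z, Tri v w z
    · obtain ⟨_, i, j, k, rfl, rfl, rfl, ht⟩ := h'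
      rcases hexThird_cases _ _ _ ht with rfl | rfl | hij
      · rw [hcell] at hw; cases hw
        exact ⟨i, rfl, Or.inr rfl⟩
      · rw [hcell'] at hw; cases hw
        exact ⟨_, rfl, Or.inl rfl⟩
      · obtain ⟨t, ht, -⟩ := even hij hw
        cases ht
    · exact absurd ((e2 h').trans hw) (h w)
  · rintro ⟨i, rfl, rfl | rfl⟩ w hw
    · obtain ⟨i, rfl⟩ : ∃ j, i = j + 1 := ⟨i - 1, by simp⟩
      obtain ⟨h1, h2⟩ := inl_of hw
      obtain ⟨k, hk⟩ := hexThird_succ i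
      exact h1 ⟨_, _, _, k, rfl, hδ.inj _ _ _ _ h2 (hcell' i), rfl, hexThird_swap _ _ _ hk⟩
    · obtain ⟨h1, h2⟩ := inl_of hw
      obtain ⟨k, hk⟩ := hexThird_succ i
      exact h1 ⟨_, _, _, k, rfl, hδ.inj _ _ _ _ h2 (hcell i), rfl, hk⟩

theorem exists_two_mul_eq_one {q : ℕ} (hq : Odd q) : ∃ h : ZMod q, 2 * h = 1 := by
  obtain ⟨k, rfl⟩ := hq
  refine ⟨-(k : ℕ), ?_⟩
  have := ZMod.natCast_self (2 * k + 1)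
  push_cast at this ⊢
  linear_combination -this

theorem exists_link (hP : P.carrier.Finite) (h10 : 10 ≤ P.carrier.ncard)
    (h6 : P.carrier.ncard % 6 = 4) {a : Fin 6 → α} (ha : Function.Injective a)
    (haO : ∀ i, a i ∈ P.O2) :
    ∃ (T : Type) (δ : T → T → α ⊕ T) (u : Fin 6 → T), Finite T ∧
      Nat.card T = 2 * (P.carrier.ncard - 1) ∧ P.IsLink δ ∧ Function.Injective u ∧
      ∀ v, ∀ p ∈ P.carrier,
        (∀ w, δ v w ≠ Sum.inl p) ↔ ∃ i, v = u i ∧ (p = a i ∨ p = a (i + 1)) := by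
  classical
  obtain ⟨q, hq⟩ : ∃ q, P.carrier.ncard - 1 = 3 * q := ⟨(P.carrier.ncard - 1) / 3, by omega⟩
  have hodd : Odd q := Nat.odd_iff.2 (by omega)
  have hq2 : 2 < q := by omega
  have : NeZero q := ⟨by omega⟩
  have : Fact (1 < q) := ⟨by omega⟩
  obtain ⟨h, hh⟩ := exists_two_mul_eq_one hodd
  have h2 : (2 : ZMod q) ≠ 0 := fun h' => by simp [h'] at hh
  have h12 : (1 : ZMod q) ≠ 2 := fun h' => one_ne_zero (α := ZMod q) (by linear_combination -h')
  let d : Fin 6 → ZMod 3 × ZMod q := ![(0, 0), (2, 0), (2, 1), (1, 1), (1, 2), (0, 2)]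
  have h3 : (1 : ZMod 3) ≠ 0 ∧ (2 : ZMod 3) ≠ 0 ∧ (1 : ZMod 3) ≠ 2 := by decide
  have hd : Function.Injective d := by
    intro i j hij
    fin_cases i <;> fin_cases j <;>
      simp [d, h2, h2.symm, h12, h12.symm, h3, h3.2.1.symm, h3.2.2.symm] at hij ⊢
  let t : Finset α := hP.toFinset.erase P.one
  have ht : ∀ p, p ∈ t ↔ p ≠ P.one ∧ p ∈ P.carrier := fun p => by simp [t]
  have htc : Fintype.card (ZMod 3 × ZMod q) = t.card := by
    rw [Finset.card_erase_of_mem (by simpa using P.one_mem), ← Set.ncard_eq_toFinset_card _ hP, hq]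
    simp [ZMod.card]
  have hf : ∀ i, a (Function.invFun d (d i) + 1) = a (i + 1) := fun i => by
    rw [Function.leftInverse_invFun hd]
  obtain ⟨g, hg⟩ := Finset.exists_equiv_extend_of_card_eq htc
    (s := Finset.univ.image d) (f := fun b => a (Function.invFun d b + 1))
    (by
      intro p hp
      simp only [Finset.mem_image, Finset.mem_univ, true_and, exists_exists_eq_and] at hp
      obtain ⟨i, rfl⟩ := hp
      exact (ht _).2 ⟨(haO _).2.1, (haO _).1⟩)
    (by
      intro x hx y hy hxy
      simp only [Finset.coe_image, Finset.coe_univ, Set.image_univ, Set.mem_range] at hx hy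
      obtain ⟨i, rfl⟩ := hx
      obtain ⟨j, rfl⟩ := hy
      simp only [hf] at hxy
      rw [add_right_cancel (ha hxy)])
  have hgd : ∀ i, (g (d i) : α) = a (i + 1) := fun i => by
    rw [hg _ (Finset.mem_image_of_mem d (Finset.mem_univ i)), hf]
  let g' : ZMod 3 × ZMod q → α := fun b => g b
  have hgmem : ∀ b, g' b ≠ P.one ∧ g' b ∈ P.carrier := fun b => (ht _).1 (g b).2
  have hL := isLink_layers hh (P := P) (g := g') (fun x y hxy => g.injective (Subtype.ext hxy))
    (fun b => (hgmem b).2) (fun b => (hgmem b).1)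
  have hgd' : ∀ i b, b = d i → g' b = a (i + 1) := fun i b hb => hb ▸ hgd i
  have hai : ∀ i, P.inv (a i) = a i := fun i => inv_eq_self (haO i)
  let u : Fin 6 → Bool × ZMod 3 × ZMod q := ![(false, 0, 0), (true, 0, 0), (false, 1, 0),
    (true, 0, 1), (false, 2, 0), (true, 0, 2)]
  have hu : Function.Injective u := by
    intro i j hij
    fin_cases i <;> fin_cases j <;>
      simp [u, h2, h2.symm, h12, h12.symm, h3, h3.2.1.symm, h3.2.2.symm] at hij ⊢
  have hsurj := layers_surj (P := P) (h := h) (g := g') fun p hp hp1 =>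
    ⟨g.symm ⟨p, (ht p).2 ⟨hp1, hp⟩⟩, by simp [g']⟩
  have hz : (-1 : ZMod 3) = 2 ∧ (-2 : ZMod 3) = 1 := by decide
  obtain ⟨δ, hδ, hgap⟩ := hL.exists_trade (fun v p hp => hsurj v hp) hu hai
    (by
      intro i
      fin_cases i
      · exact congrArg Sum.inl (hgd' 0 _ (by simp [d]; rfl))
      · exact congrArg Sum.inl ((congrArg P.inv (hgd' 1 _ (by simp [d, hz]))).trans (hai _))
      · exact congrArg Sum.inl (hgd' 2 _ (by simp [d, hz]))
      · exact congrArg Sum.inl ((congrArg P.inv (hgd' 3 _ (by simp [d, hz]))).trans (hai _))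
      · exact congrArg Sum.inl (hgd' 4 _ (by simp [d, hz]))
      · exact congrArg Sum.inl ((congrArg P.inv (hgd' 5 _ (by simp [d]))).trans (hai _)))
    (by simp [u, layers, bose, hz])
  refine ⟨_, δ, u, inferInstance, ?_, hδ, hu, hgap⟩
  rw [hq]
  simp [Nat.card_eq_fintype_card, ZMod.card]

/-- Adjoining involutions so that the only new gaps form a closed walk
`a 0, u 0, a 1, u 1, …, a 5, u 5` of length twelve. -/
theorem exists_dodecagon [Infinite α] (hP : P.carrier.Finite) (h4 : Cond4 P) {a : Fin 6 → α}
    (ha : Function.Injective a) (haO : ∀ i, a i ∈ P.O2) :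
    ∃ (Q : PartialIPLoop α) (u : Fin 6 → α), Q.carrier.Finite ∧ P.Ext Q ∧ Cond4 Q ∧
      Q.carrier \ P.carrier ⊆ Q.O2 ∧ Function.Injective u ∧ (∀ i, u i ∉ P.carrier) ∧
      ∀ x y, (x, y) ∈ Q.gaps ↔ (x, y) ∈ P.gaps ∨
        (∃ i, x = u i ∧ (y = a i ∨ y = a (i + 1))) ∨
        ∃ i, y = u i ∧ (x = a i ∨ x = a (i + 1)) := by
  obtain ⟨hO3, h10, h6, h2⟩ := h4
  obtain ⟨T, δ, u, hT, hcard, hδ, hu, hgap⟩ := exists_link hP h10 h6 ha haO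
  have := hP.infinite_compl.to_subtype
  let e : T → α := fun v => Infinite.natEmbedding (P.carrierᶜ : Set α) (Finite.equivFin T v)
  have he : Function.Injective e := fun v w h => (Finite.equivFin T).injective
    (Fin.ext ((Infinite.natEmbedding _).injective (Subtype.ext h)))
  have heP : ∀ v, e v ∉ P.carrier := fun v => (Infinite.natEmbedding (P.carrierᶜ : Set α) _).2
  obtain ⟨Q, hC, hext, heO, hQ⟩ := exists_glue hδ e he heP
  have hiff : ∀ p ∈ P.carrier, ∀ i, P.inv p = a i ↔ p = a i := fun p hp i =>
    ⟨fun h => by rw [← inv_inv hp, h, inv_eq_self (haO i)],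
      fun h => by rw [h, inv_eq_self (haO i)]⟩
  have hgap' : ∀ v, ∀ p ∈ P.carrier,
      (∀ w, δ w v ≠ Sum.inl p) ↔ ∃ i, v = u i ∧ (p = a i ∨ p = a (i + 1)) := by
    intro v p hp
    simp only [← hiff p hp]
    rw [← hgap v _ (P.inv_mem p hp)]
    refine forall_congr' fun w => not_congr ⟨fun h => hδ.inv _ _ _ h, fun h => ?_⟩
    rw [hδ.inv _ _ _ h, inv_inv hp]
  have haC : ∀ i, a i ∈ P.carrier := fun i => (haO i).1
  have hQ' : ∀ x y, (x, y) ∈ Q.gaps ↔ (x, y) ∈ P.gaps ∨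
        (∃ i, x = e (u i) ∧ (y = a i ∨ y = a (i + 1))) ∨
        ∃ i, y = e (u i) ∧ (x = a i ∨ x = a (i + 1)) := by
    intro x y
    rw [hQ]
    refine or_congr Iff.rfl (or_congr ⟨?_, ?_⟩ ⟨?_, ?_⟩)
    · rintro ⟨v, rfl, hy, h⟩
      obtain ⟨i, rfl, hi⟩ := (hgap v y hy).1 h
      exact ⟨i, rfl, hi⟩
    · rintro ⟨i, rfl, hi⟩
      have hy : y ∈ P.carrier := by rcases hi with rfl | rfl <;> exact haC _
      exact ⟨_, rfl, hy, (hgap _ y hy).2 ⟨i, rfl, hi⟩⟩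
    · rintro ⟨v, rfl, hx, h⟩
      obtain ⟨i, rfl, hi⟩ := (hgap' v x hx).1 h
      exact ⟨i, rfl, hi⟩
    · rintro ⟨i, rfl, hi⟩
      have hx : x ∈ P.carrier := by rcases hi with rfl | rfl <;> exact haC _
      exact ⟨_, rfl, hx, (hgap' _ x hx).2 ⟨i, rfl, hi⟩⟩
  have hnew : Q.carrier \ P.carrier ⊆ Q.O2 := by
    rintro x ⟨hx, hx'⟩
    rw [hC] at hx
    obtain ⟨v, rfl⟩ := hx.resolve_left hx'
    exact heO v
  have hcQ : Q.carrier.ncard = P.carrier.ncard + 2 * (P.carrier.ncard - 1) := by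
    rw [hC, Set.ncard_union_eq _ hP (Set.finite_range e), Set.ncard_range_of_injective he, hcard]
    rw [Set.disjoint_right]
    rintro _ ⟨v, rfl⟩
    exact heP v
  refine ⟨Q, fun i => e (u i), hC ▸ hP.union (Set.finite_range e), hext,
    ⟨(hext.O3_eq h2 hnew).symm ▸ hO3, by omega, by omega, ?_⟩, hnew, he.comp hu,
    fun i => heP _, hQ'⟩
  rintro ⟨x, y⟩ h
  have hmem : ∀ {z i}, z = a i ∨ z = a (i + 1) → z ∈ Q.O2 := by
    rintro z i (rfl | rfl) <;> exact hext.O2_subset (haO _)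
  rcases (hQ' x y).1 h with h' | ⟨i, rfl, h'⟩ | ⟨i, rfl, h'⟩
  · exact ⟨hext.O2_subset (h2 h').1, hext.O2_subset (h2 h').2⟩
  · exact ⟨heO _, hmem h'⟩
  · exact ⟨hmem h', heO _⟩

theorem Ext.cond4 (h : P.Ext Q) (hC : Q.carrier = P.carrier) (hg : Q.gaps ⊆ P.gaps)
    (h4 : Cond4 P) : Cond4 Q := by
  obtain ⟨hO3, h10, h6, h2⟩ := h4
  refine ⟨?_, hC ▸ h10, hC ▸ h6, fun z hz => ⟨h.O2_subset (h2 (hg hz)).1,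
    h.O2_subset (h2 (hg hz)).2⟩⟩
  rwa [h.O3_eq h2 (by rw [hC, Set.sdiff_self]; exact Set.empty_subset _)]

/-- Filling the triangles on the sides in `s` of the walk of `exists_dodecagon`. -/
theorem exists_roof [Infinite α] (hP : P.carrier.Finite) (h4 : Cond4 P) {a : Fin 6 → α}
    (ha : Function.Injective a) (haO : ∀ i, a i ∈ P.O2) (s : Finset (Fin 6))
    (hs : ∀ i ∈ s, (a i, a (i + 1)) ∈ P.gaps) :
    ∃ (Q : PartialIPLoop α) (u : Fin 6 → α), Q.carrier.Finite ∧ P.Ext Q ∧ Cond4 Q ∧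
      Q.gaps.ncard + 6 * s.card ≤ P.gaps.ncard + 24 ∧
      Function.Injective u ∧ (∀ i, u i ∉ P.carrier) ∧
      (∀ i ∉ s, (a i, u i) ∈ Q.gaps ∧ (u i, a (i + 1)) ∈ Q.gaps) ∧
      ∀ x y, (x, y) ∈ P.gaps →
        (∀ i ∈ s, ¬ (x = a i ∧ y = a (i + 1)) ∧ ¬ (y = a i ∧ x = a (i + 1))) →
        (x, y) ∈ Q.gaps := by
  classical
  obtain ⟨R, u, hRf, hPR, hR4, hRO, hu, huP, hR⟩ := exists_dodecagon hP h4 ha haO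
  have h2 := h4.2.2.2
  have hua : ∀ i j, u i ≠ a j := fun i j h => huP i (h ▸ (haO j).1)
  have hau : ∀ i j, a i ≠ u j := fun i j h => hua j i h.symm
  have hcyc : ∀ i j : Fin 6, i = j + 1 → i + 1 = j → False := by decide
  have hne : ∀ i : Fin 6, i ≠ i + 1 := by decide
  have hs' : ∀ i ∈ s, (a i, a (i + 1)) ∈ R.gaps ∧ (a (i + 1), a i) ∈ R.gaps := fun i hi =>
    ⟨(hR _ _).2 (Or.inl (hs i hi)), (hR _ _).2 (Or.inl (gap_symm h2 (hs i hi)))⟩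
  have hRu : ∀ i z, (z = a i ∨ z = a (i + 1)) → (u i, z) ∈ R.gaps ∧ (z, u i) ∈ R.gaps :=
    fun i z hz => ⟨(hR _ _).2 (Or.inr (Or.inl ⟨i, rfl, hz⟩)),
      (hR _ _).2 (Or.inr (Or.inr ⟨i, rfl, hz⟩))⟩
  obtain ⟨Q, hC, hRQ, hQ⟩ := exists_fill (P := R) (s : Set (Fin 6)) a (fun i => a (i + 1)) u
    hR4.2.2.2
    (by
      rintro i hi x y z (⟨rfl, rfl, rfl⟩ | ⟨rfl, rfl, rfl⟩ | ⟨rfl, rfl, rfl⟩ | ⟨rfl, rfl, rfl⟩ |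
        ⟨rfl, rfl, rfl⟩ | ⟨rfl, rfl, rfl⟩)
      · exact (hs' i hi).1
      · exact (hRu i _ (Or.inl rfl)).2
      · exact (hs' i hi).2
      · exact (hRu i _ (Or.inr rfl)).2
      · exact (hRu i _ (Or.inl rfl)).1
      · exact (hRu i _ (Or.inr rfl)).1)
    (by
      have hai : ∀ i j, a i = a j → i = j := fun i j h => ha h
      have hui : ∀ i j, u i = u j → i = j := fun i j h => hu h
      rintro i hi j hj x y z z' (⟨rfl, rfl, rfl⟩ | ⟨rfl, rfl, rfl⟩ | ⟨rfl, rfl, rfl⟩ |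
        ⟨rfl, rfl, rfl⟩ | ⟨rfl, rfl, rfl⟩ | ⟨rfl, rfl, rfl⟩) (⟨h1, h2, rfl⟩ | ⟨h1, h2, rfl⟩ |
        ⟨h1, h2, rfl⟩ | ⟨h1, h2, rfl⟩ | ⟨h1, h2, rfl⟩ | ⟨h1, h2, rfl⟩) <;>
      first
      | exact absurd h1 (hua _ _)
      | exact absurd h1 (hau _ _)
      | exact absurd h2 (hua _ _)
      | exact absurd h2 (hau _ _)
      | (cases hai _ _ h1; rfl)
      | (cases hai _ _ h2; rfl)
      | (cases hui _ _ h1; rfl)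
      | (cases hui _ _ h2; rfl)
      | (cases hui _ _ h1; exact absurd (hai _ _ h2) (hne _))
      | (cases hui _ _ h1; exact absurd (hai _ _ h2).symm (hne _))
      | (cases hui _ _ h2; exact absurd (hai _ _ h1) (hne _))
      | (cases hui _ _ h2; exact absurd (hai _ _ h1).symm (hne _))
      | exact (hcyc _ _ (hai _ _ h1) (hai _ _ h2)).elim
      | exact (hcyc _ _ (hai _ _ h2) (hai _ _ h1)).elim)
  have hQR : Q.gaps ⊆ R.gaps := fun ⟨x, y⟩ h => ((hQ x y).1 h).1
  refine ⟨Q, u, hC ▸ hRf, hPR.trans hRQ, hRQ.cond4 hC hQR hR4, ?_, hu, huP, fun i hi =>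
    ⟨(hQ _ _).2 ⟨(hRu i _ (Or.inl rfl)).2, ?_⟩, (hQ _ _).2 ⟨(hRu i _ (Or.inr rfl)).1, ?_⟩⟩,
    fun x y hxy hxs => (hQ _ _).2 ⟨(hR _ _).2 (Or.inl hxy), ?_⟩⟩
  · let E : Finset (α × α) := (s ×ˢ (Finset.univ : Finset Bool)).image fun w =>
      if w.2 then (a w.1, a (w.1 + 1)) else (a (w.1 + 1), a w.1)
    have hE : E.card = s.card * 2 := by
      rw [Finset.card_image_of_injective, Finset.card_product]
      · rfl
      · rintro ⟨i, _ | _⟩ ⟨j, _ | _⟩ h <;>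
          simp only [Bool.false_eq_true, if_true, if_false, Prod.mk.injEq] at h
        · rw [ha h.2]
        · exact (hcyc _ _ (ha h.2) (ha h.1)).elim
        · exact (hcyc _ _ (ha h.1) (ha h.2)).elim
        · rw [ha h.1]
    have hEP : (E : Set (α × α)) ⊆ P.gaps := by
      intro z hz
      obtain ⟨⟨i, b⟩, hi, rfl⟩ := Finset.mem_image.1 (Finset.mem_coe.1 hz)
      have hi' := hs i (Finset.mem_product.1 hi).1
      cases b
      · exact gap_symm h2 hi'
      · exact hi'
    let F : Finset (α × α) := sᶜ.biUnion fun i =>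
      {(u i, a i), (u i, a (i + 1)), (a i, u i), (a (i + 1), u i)}
    have hF : F.card ≤ sᶜ.card * 4 :=
      Finset.card_biUnion_le_card_mul _ _ _ fun i _ => Finset.card_le_four
    have hsub : Q.gaps ⊆ (P.gaps \ E) ∪ F := by
      rintro ⟨x, y⟩ h
      obtain ⟨h1, h3⟩ := (hQ x y).1 h
      rcases (hR x y).1 h1 with h6 | ⟨i, rfl, h6⟩ | ⟨i, rfl, h6⟩
      · refine Or.inl ⟨h6, fun hE => h3 ?_⟩
        obtain ⟨⟨i, b⟩, hi, h5⟩ := Finset.mem_image.1 (Finset.mem_coe.1 hE)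
        refine ⟨i, (Finset.mem_product.1 hi).1, u i, ?_⟩
        cases b <;> cases h5
        · exact Or.inr (Or.inr (Or.inl ⟨rfl, rfl, rfl⟩))
        · exact Or.inl ⟨rfl, rfl, rfl⟩
      · have hi : i ∉ s := fun hi => h3 (by
          rcases h6 with rfl | rfl
          · exact ⟨i, hi, _, Or.inr (Or.inr (Or.inr (Or.inr (Or.inl ⟨rfl, rfl, rfl⟩))))⟩
          · exact ⟨i, hi, _, Or.inr (Or.inr (Or.inr (Or.inr (Or.inr ⟨rfl, rfl, rfl⟩))))⟩)
        refine Or.inr (Finset.mem_coe.2 (Finset.mem_biUnion.2 ⟨i, Finset.mem_compl.2 hi, ?_⟩))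
        rcases h6 with rfl | rfl <;> simp
      · have hi : i ∉ s := fun hi => h3 (by
          rcases h6 with rfl | rfl
          · exact ⟨i, hi, _, Or.inr (Or.inl ⟨rfl, rfl, rfl⟩)⟩
          · exact ⟨i, hi, _, Or.inr (Or.inr (Or.inr (Or.inl ⟨rfl, rfl, rfl⟩)))⟩)
        refine Or.inr (Finset.mem_coe.2 (Finset.mem_biUnion.2 ⟨i, Finset.mem_compl.2 hi, ?_⟩))
        rcases h6 with rfl | rfl <;> simp
    have hfin := gaps_finite hP
    have hle := Set.ncard_le_ncard hsub ((hfin.subset Set.sdiff_subset).union F.finite_toSet)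
    have hle' := Set.ncard_union_le (P.gaps \ E) (F : Set (α × α))
    have hd := Set.ncard_sdiff_add_ncard_of_subset hEP hfin
    have hle6 := Finset.card_le_univ s
    rw [Set.ncard_coe_finset] at hle' hd
    rw [Finset.card_compl] at hF
    simp only [Fintype.card_fin] at hF hle6
    omega
  · rintro ⟨j, hj, z, (⟨h1, h2, rfl⟩ | ⟨h1, h2, rfl⟩ | ⟨h1, h2, rfl⟩ | ⟨h1, h2, rfl⟩ |
        ⟨h1, h2, rfl⟩ | ⟨h1, h2, rfl⟩)⟩
    · exact hua _ _ h2
    · exact hi (hu h2 ▸ hj)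
    · exact hua _ _ h2
    · exact hi (hu h2 ▸ hj)
    · exact hau _ _ h1
    · exact hau _ _ h1
  · rintro ⟨j, hj, z, (⟨h1, h2, rfl⟩ | ⟨h1, h2, rfl⟩ | ⟨h1, h2, rfl⟩ | ⟨h1, h2, rfl⟩ |
        ⟨h1, h2, rfl⟩ | ⟨h1, h2, rfl⟩)⟩
    · exact hua _ _ h1
    · exact hua _ _ h1
    · exact hua _ _ h1
    · exact hua _ _ h1
    · exact hi (hu h1 ▸ hj)
    · exact hi (hu h1 ▸ hj)
  · have huR : ∀ i, x ≠ u i ∧ y ≠ u i := fun i =>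
      ⟨fun h => huP i (h ▸ hxy.1.1), fun h => huP i (h ▸ hxy.1.2)⟩
    rintro ⟨j, hj, z, (⟨h1, h2, rfl⟩ | ⟨h1, h2, rfl⟩ | ⟨h1, h2, rfl⟩ | ⟨h1, h2, rfl⟩ |
        ⟨h1, h2, rfl⟩ | ⟨h1, h2, rfl⟩)⟩
    · exact (hxs j hj).1 ⟨h1, h2⟩
    · exact (huR j).2 h2
    · exact (hxs j hj).2 ⟨h2, h1⟩
    · exact (huR j).2 h2
    · exact (huR j).1 h1
    · exact (huR j).1 h1

/-- The conclusion of the main theorem: `P` has an extension with fewer gaps. -/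
def Reducible (P : PartialIPLoop α) : Prop :=
  ∃ Q : PartialIPLoop α, Q.carrier.Finite ∧ P.Ext Q ∧ Cond4 Q ∧ Q.gaps.ncard < P.gaps.ncard

theorem Ext.reducible (h : P.Ext Q) (hle : Q.gaps.ncard ≤ P.gaps.ncard) (hQ : Q.Reducible) :
    P.Reducible :=
  let ⟨R, hR, hQR, hR4, hlt⟩ := hQ
  ⟨R, hR, h.trans hQR, hR4, hlt.trans_le hle⟩

theorem exists_gap_notMem_list (hP : P.carrier.Finite) (h4 : Cond4 P) (l : List (α × α))
    (hl : l.Nodup) (h3 : ¬ 3 ∣ l.length) (hlP : ∀ z ∈ l, z ∈ P.gaps) :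
    ∃ x y, (x, y) ∈ P.gaps ∧ (x, y) ∉ l := by
  classical
  by_contra! h
  have hgaps : P.gaps = l.toFinset := by
    ext ⟨x, y⟩
    rw [List.coe_toFinset]
    exact ⟨h x y, hlP _⟩
  have h3' := three_dvd_ncard_gaps hP h4
  rw [hgaps, Set.ncard_coe_finset, List.toFinset_card_of_nodup hl] at h3'
  exact h3 h3'

theorem reducible_of_triangle (hP : P.carrier.Finite) (h4 : Cond4 P) {a b c : α}
    (hab : (a, b) ∈ P.gaps) (hbc : (b, c) ∈ P.gaps) (hac : (a, c) ∈ P.gaps) : P.Reducible := by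
  have h2 := h4.2.2.2
  have nab := gap_ne h2 hab
  have nbc := gap_ne h2 hbc
  have nac := gap_ne h2 hac
  obtain ⟨Q, hC, hext, hQ⟩ := exists_fill (P := P) (Set.univ : Set Unit) (fun _ => a)
    (fun _ => b) (fun _ => c) h2
    (by
      rintro - - x y z (⟨rfl, rfl, rfl⟩ | ⟨rfl, rfl, rfl⟩ | ⟨rfl, rfl, rfl⟩ | ⟨rfl, rfl, rfl⟩ |
        ⟨rfl, rfl, rfl⟩ | ⟨rfl, rfl, rfl⟩)
      exacts [hab, hac, gap_symm h2 hab, hbc, gap_symm h2 hac, gap_symm h2 hbc])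
    (by
      intro _ _ _ _ x y z z' h h'
      unfold IsArrangement at h h'
      grind)
  have hsub : Q.gaps ⊆ P.gaps := fun ⟨x, y⟩ h => ((hQ x y).1 h).1
  refine ⟨Q, hC ▸ hP, hext, hext.cond4 hC hsub h4, Set.ncard_lt_ncard ⟨hsub, fun h => ?_⟩
    (gaps_finite hP)⟩
  exact ((hQ a b).1 (h hab)).2 ⟨(), trivial, c, Or.inl ⟨rfl, rfl, rfl⟩⟩

theorem injective_of_nodup {a b c d e f : α} (h : [a, b, c, d, e, f].Nodup) :
    Function.Injective ![a, b, c, d, e, f] :=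
  List.nodup_ofFn.1 (by simpa using h)

theorem reducible_of_path_six [Infinite α] (hP : P.carrier.Finite) (h4 : Cond4 P)
    {a b c d e f : α} (hab : (a, b) ∈ P.gaps) (hbc : (b, c) ∈ P.gaps) (hcd : (c, d) ∈ P.gaps)
    (hde : (d, e) ∈ P.gaps) (hef : (e, f) ∈ P.gaps) (hnd : [a, b, c, d, e, f].Nodup) :
    P.Reducible := by
  have h2 := h4.2.2.2
  obtain ⟨Q, u, hQ, hext, hQ4, hle, -⟩ := exists_roof hP h4 (injective_of_nodup hnd)
    (by
      intro i
      fin_cases i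
      exacts [(h2 hab).1, (h2 hbc).1, (h2 hcd).1, (h2 hde).1, (h2 hef).1, (h2 hef).2])
    {0, 1, 2, 3, 4}
    (by
      simp only [Finset.mem_insert, Finset.mem_singleton, forall_eq_or_imp, forall_eq]
      exact ⟨hab, hbc, hcd, hde, hef⟩)
  have hcard : ({0, 1, 2, 3, 4} : Finset (Fin 6)).card = 5 := by decide
  exact ⟨Q, hQ, hext, hQ4, by omega⟩

theorem exists_roof_path_five [Infinite α] (hP : P.carrier.Finite) (h4 : Cond4 P)
    {a b c d e f : α} (hab : (a, b) ∈ P.gaps) (hbc : (b, c) ∈ P.gaps) (hcd : (c, d) ∈ P.gaps)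
    (hde : (d, e) ∈ P.gaps) (hf : f ∈ P.O2) (hnd : [a, b, c, d, e, f].Nodup) :
    ∃ (Q : PartialIPLoop α) (u v : α), Q.carrier.Finite ∧ P.Ext Q ∧ Cond4 Q ∧
      Q.gaps.ncard ≤ P.gaps.ncard ∧ u ≠ v ∧ u ∉ P.carrier ∧ v ∉ P.carrier ∧
      (e, u) ∈ Q.gaps ∧ (u, f) ∈ Q.gaps ∧ (f, v) ∈ Q.gaps ∧ (v, a) ∈ Q.gaps ∧
      ∀ x y, (x, y) ∈ P.gaps → (x, y) ∉ [(a, b), (b, c), (c, d), (d, e)] →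
        (y, x) ∉ [(a, b), (b, c), (c, d), (d, e)] → (x, y) ∈ Q.gaps := by
  have h2 := h4.2.2.2
  obtain ⟨Q, u, hQ, hext, hQ4, hle, hu, huP, hroof, hPQ⟩ := exists_roof hP h4
    (injective_of_nodup hnd)
    (by
      intro i
      fin_cases i
      exacts [(h2 hab).1, (h2 hbc).1, (h2 hcd).1, (h2 hde).1, (h2 hde).2, hf])
    {0, 1, 2, 3}
    (by
      simp only [Finset.mem_insert, Finset.mem_singleton, forall_eq_or_imp, forall_eq]
      exact ⟨hab, hbc, hcd, hde⟩)
  have hcard : ({0, 1, 2, 3} : Finset (Fin 6)).card = 4 := by decide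
  obtain ⟨h44, h45⟩ := hroof 4 (by decide)
  obtain ⟨h55, h50⟩ := hroof 5 (by decide)
  refine ⟨Q, u 4, u 5, hQ, hext, hQ4, by omega, fun h => absurd (hu h) (by decide), huP 4,
    huP 5, h44, h45, h55, h50, fun x y hxy h h' => hPQ x y hxy ?_⟩
  simp only [List.mem_cons, Prod.mk.injEq, List.not_mem_nil, or_false, not_or] at h h'
  simp only [Finset.mem_insert, Finset.mem_singleton, forall_eq_or_imp, forall_eq]
  exact ⟨⟨h.1, h'.1⟩, ⟨h.2.1, h'.2.1⟩, ⟨h.2.2.1, h'.2.2.1⟩, ⟨h.2.2.2, h'.2.2.2⟩⟩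

theorem nodup_four_cycle_pairs {a b c d : α} (h : [a, b, c, d].Nodup) :
    [(a, b), (b, a), (b, c), (c, b), (c, d), (d, c), (d, a), (a, d)].Nodup := by
  simp only [List.nodup_cons, List.mem_cons, List.not_mem_nil, or_false, not_or,
    not_false_eq_true, List.nodup_nil, and_true] at h
  obtain ⟨⟨nab, nac, nad⟩, ⟨nbc, nbd⟩, ncd⟩ := h
  simp [nab, nac, nad, nbc, nbd, ncd, Ne.symm nab, Ne.symm nac, Ne.symm nad, Ne.symm nbc,
    Ne.symm ncd]

theorem nodup_five_cycle_pairs {a b c d e : α} (h : [a, b, c, d, e].Nodup) :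
    [(a, b), (b, a), (b, c), (c, b), (c, d), (d, c), (d, e), (e, d), (e, a), (a, e)].Nodup := by
  simp only [List.nodup_cons, List.mem_cons, List.not_mem_nil, or_false, not_or,
    not_false_eq_true, List.nodup_nil, and_true] at h
  obtain ⟨⟨nab, nac, nad, nae⟩, ⟨nbc, nbd, nbe⟩, ⟨ncd, nce⟩, nde⟩ := h
  simp [nab, nac, nad, nae, nbc, nbd, nbe, ncd, nce, nde, Ne.symm nab, Ne.symm nac, Ne.symm nad,
    Ne.symm nae, Ne.symm nbc, Ne.symm ncd, Ne.symm nde]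

theorem reducible_of_path_five [Infinite α] (hP : P.carrier.Finite) (h4 : Cond4 P)
    {a b c d e : α} (hab : (a, b) ∈ P.gaps) (hbc : (b, c) ∈ P.gaps) (hcd : (c, d) ∈ P.gaps)
    (hde : (d, e) ∈ P.gaps) (hnd : [a, b, c, d, e].Nodup) : P.Reducible := by
  have h2 := h4.2.2.2
  by_contra hR
  have tri : ∀ x y z, (x, y) ∈ P.gaps → (y, z) ∈ P.gaps → (x, z) ∈ P.gaps → False :=
    fun x y z h h' h'' => hR (reducible_of_triangle hP h4 h h' h'')
  have path : ∀ x y z u v w, (x, y) ∈ P.gaps → (y, z) ∈ P.gaps → (z, u) ∈ P.gaps →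
      (u, v) ∈ P.gaps → (v, w) ∈ P.gaps → [x, y, z, u, v, w].Nodup → False :=
    fun x y z u v w h1 h2 h3 h4' h5 h6 => hR (reducible_of_path_six hP h4 h1 h2 h3 h4' h5 h6)
  have fresh : ∀ x y w, (x, y) ∈ P.gaps → w ∉ P.carrier → x ≠ w :=
    fun x y w h hw hxw => hw (hxw ▸ h.1.1)
  have hba := gap_symm h2 hab
  have hcb := gap_symm h2 hbc
  have hdc := gap_symm h2 hcd
  have hed := gap_symm h2 hde
  have hpairs := nodup_five_cycle_pairs hnd
  simp only [List.nodup_cons, List.mem_cons, List.not_mem_nil, or_false, not_or,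
    not_false_eq_true, List.nodup_nil, and_true] at hnd
  obtain ⟨⟨nab, nac, nad, nae⟩, ⟨nbc, nbd, nbe⟩, ⟨ncd, nce⟩, nde⟩ := hnd
  by_cases hea : (e, a) ∈ P.gaps
  · have hae := gap_symm h2 hea
    have out : ∀ x y, (x, y) ∈ P.gaps → x ∉ [a, b, c, d, e] → y ∉ [a, b, c, d, e] := by
      intro x y hxy hx hy
      simp only [List.mem_cons, List.not_mem_nil, or_false, not_or] at hx hy
      obtain ⟨nxa, nxb, nxc, nxd, nxe⟩ := hx
      rcases hy with rfl | rfl | rfl | rfl | rfl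
      · refine path _ _ _ _ _ _ hxy hab hbc hcd hde ?_
        simp only [List.nodup_cons, List.mem_cons, List.not_mem_nil, or_false, not_or,
          not_false_eq_true, List.nodup_nil, and_true]
        and_intros <;> assumption
      · refine path _ _ _ _ _ _ hxy hbc hcd hde hea ?_
        simp only [List.nodup_cons, List.mem_cons, List.not_mem_nil, or_false, not_or,
          not_false_eq_true, List.nodup_nil, and_true]
        and_intros <;> first | assumption | exact Ne.symm ‹_›
      · refine path _ _ _ _ _ _ hxy hcd hde hea hab ?_
        simp only [List.nodup_cons, List.mem_cons, List.not_mem_nil, or_false, not_or,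
          not_false_eq_true, List.nodup_nil, and_true]
        and_intros <;> first | assumption | exact Ne.symm ‹_›
      · refine path _ _ _ _ _ _ hxy hde hea hab hbc ?_
        simp only [List.nodup_cons, List.mem_cons, List.not_mem_nil, or_false, not_or,
          not_false_eq_true, List.nodup_nil, and_true]
        and_intros <;> first | assumption | exact Ne.symm ‹_›
      · refine path _ _ _ _ _ _ hxy hea hab hbc hcd ?_
        simp only [List.nodup_cons, List.mem_cons, List.not_mem_nil, or_false, not_or,
          not_false_eq_true, List.nodup_nil, and_true]
        and_intros <;> first | assumption | exact Ne.symm ‹_›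
    obtain ⟨g, h, hgh, hS⟩ := exists_gap_notMem_list hP h4 _ hpairs (by simp) (by simp [*])
    have ngh := gap_ne h2 hgh
    by_cases hg : g ∈ [a, b, c, d, e]
    · have hh : h ∈ [a, b, c, d, e] := by_contra fun hh => out h g (gap_symm h2 hgh) hh hg
      simp only [List.mem_cons, List.not_mem_nil, or_false] at hg hh
      rcases hg with rfl | rfl | rfl | rfl | rfl <;> rcases hh with rfl | rfl | rfl | rfl | rfl <;>
      first
      | exact ngh rfl
      | exact tri _ _ _ hab hbc hgh
      | exact tri _ _ _ hbc hcd hgh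
      | exact tri _ _ _ hcd hde hgh
      | exact tri _ _ _ hde hea hgh
      | exact tri _ _ _ hea hab hgh
      | exact tri _ _ _ hcb hba hgh
      | exact tri _ _ _ hdc hcb hgh
      | exact tri _ _ _ hed hdc hgh
      | exact tri _ _ _ hae hed hgh
      | exact tri _ _ _ hba hae hgh
      | exact hS (by simp)
    · have hh := out g h hgh hg
      simp only [List.mem_cons, List.not_mem_nil, or_false, not_or] at hg hh
      obtain ⟨nga, ngb, ngc, ngd, nge⟩ := hg
      obtain ⟨nha, nhb, nhc, nhd, nhe⟩ := hh
      obtain ⟨Q, u, v, hQ, hext, hQ4, hle, huv, hu, hv, heu, hug, -, hva, hPQ⟩ :=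
        exists_roof_path_five hP h4 hab hbc hcd hde (h2 hgh).1 (by
          simp only [List.nodup_cons, List.mem_cons, List.not_mem_nil, or_false, not_or,
            not_false_eq_true, List.nodup_nil, and_true]
          and_intros <;> first | assumption | exact Ne.symm ‹_›)
      have nau := fresh _ _ _ hab hu
      have neu := fresh _ _ _ hea hu
      have ngu := fresh _ _ _ hgh hu
      have nhu := fresh _ _ _ (gap_symm h2 hgh) hu
      have nav := fresh _ _ _ hab hv
      have nev := fresh _ _ _ hea hv
      have ngv := fresh _ _ _ hgh hv
      have nhv := fresh _ _ _ (gap_symm h2 hgh) hv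
      refine hR (hext.reducible hle (reducible_of_path_six hQ hQ4 hva
        (hPQ a e hae ?_ ?_) heu hug (hPQ g h hgh ?_ ?_) ?_))
      · simp [nab, nac, nad, Ne.symm nbe]
      · simp [Ne.symm nae, Ne.symm nbe, Ne.symm nce, nad, Ne.symm nde]
      · simp [nga, ngb, ngc, ngd]
      · simp [nha, nhb, nhc, nhd]
      · simp only [List.nodup_cons, List.mem_cons, List.not_mem_nil, or_false, not_or,
          not_false_eq_true, List.nodup_nil, and_true]
        and_intros <;> first | assumption | exact Ne.symm ‹_›
  · obtain ⟨x, hx, hax⟩ := exists_gap_notMem hP h4 (h2 hab).1 {b} (by simpa using hab) rfl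
    obtain ⟨y, hy, hey⟩ := exists_gap_notMem hP h4 (h2 hde).2 {d} (by simpa using hed) rfl
    have nax := gap_ne h2 hax
    have ney := gap_ne h2 hey
    have hxa := gap_symm h2 hax
    have hye := gap_symm h2 hey
    simp only [Finset.mem_singleton] at hx hy
    have hxd : x = d := by
      by_contra hxd
      have hxc : x ≠ c := by rintro rfl; exact tri _ _ _ hab hbc hax
      have hxe : x ≠ e := by rintro rfl; exact hea hxa
      refine path _ _ _ _ _ _ hxa hab hbc hcd hde ?_
      simp only [List.nodup_cons, List.mem_cons, List.not_mem_nil, or_false, not_or,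
        not_false_eq_true, List.nodup_nil, and_true]
      and_intros <;> first | assumption | exact Ne.symm ‹_›
    have hyb : y = b := by
      by_contra hyb
      have hyc : y ≠ c := by rintro rfl; exact tri _ _ _ hcd hde hye
      have hya : y ≠ a := by rintro rfl; exact hea hey
      refine path _ _ _ _ _ _ hab hbc hcd hde hey ?_
      simp only [List.nodup_cons, List.mem_cons, List.not_mem_nil, or_false, not_or,
        not_false_eq_true, List.nodup_nil, and_true]
      and_intros <;> first | assumption | exact Ne.symm ‹_›
    subst x y
    obtain ⟨z, hz, hbz⟩ := exists_gap_notMem hP h4 (h2 hbc).1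
      ⟨{a, c, e}, by simp [nac, nae, nce]⟩ (by simp [hba, hbc, hye]) (by simp)
    have nbz := gap_ne h2 hbz
    replace hz : ¬ z = a ∧ ¬ z = c ∧ ¬ z = e := by simpa using hz
    obtain ⟨nza, nzc, nze⟩ := hz
    have nzd : ¬ z = d := by rintro rfl; exact tri _ _ _ hbc hcd hbz
    obtain ⟨Q, u, v, hQ, hext, hQ4, hle, huv, hu, hv, heu, huz, hzv, hva, hPQ⟩ :=
      exists_roof_path_five hP h4 hab hbc hcd hde (h2 hbz).2 (by
        simp only [List.nodup_cons, List.mem_cons, List.not_mem_nil, or_false, not_or,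
          not_false_eq_true, List.nodup_nil, and_true]
        and_intros <;> first | assumption | exact Ne.symm ‹_›)
    have hQ2 := hQ4.2.2.2
    have nau := fresh _ _ _ hab hu
    have neu := fresh _ _ _ hed hu
    have ndu := fresh _ _ _ hde hu
    have nzu := fresh _ _ _ (gap_symm h2 hbz) hu
    have nav := fresh _ _ _ hab hv
    have nev := fresh _ _ _ hed hv
    have ndv := fresh _ _ _ hde hv
    have nzv := fresh _ _ _ (gap_symm h2 hbz) hv
    refine hR (hext.reducible hle (reducible_of_path_six hQ hQ4
      (hPQ d a hxa ?_ ?_) (gap_symm hQ2 hva) (gap_symm hQ2 hzv) (gap_symm hQ2 huz)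
      (gap_symm hQ2 heu) ?_))
    · simp [Ne.symm nad, Ne.symm nbd, Ne.symm ncd, nae]
    · simp [nab, nac, nad, Ne.symm nbd]
    · simp only [List.nodup_cons, List.mem_cons, List.not_mem_nil, or_false, not_or,
        not_false_eq_true, List.nodup_nil, and_true]
      and_intros <;> first | assumption | exact Ne.symm ‹_›

theorem reducible_of_four_cycle [Infinite α] (hP : P.carrier.Finite) (h4 : Cond4 P)
    {a b c d : α} (hab : (a, b) ∈ P.gaps) (hbc : (b, c) ∈ P.gaps) (hcd : (c, d) ∈ P.gaps)
    (hda : (d, a) ∈ P.gaps) (hnd : [a, b, c, d].Nodup) : P.Reducible := by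
  have h2 := h4.2.2.2
  by_contra hR
  have tri : ∀ x y z, (x, y) ∈ P.gaps → (y, z) ∈ P.gaps → (x, z) ∈ P.gaps → False :=
    fun x y z h h' h'' => hR (reducible_of_triangle hP h4 h h' h'')
  have path : ∀ x y z u v, (x, y) ∈ P.gaps → (y, z) ∈ P.gaps → (z, u) ∈ P.gaps →
      (u, v) ∈ P.gaps → [x, y, z, u, v].Nodup → False :=
    fun x y z u v h1 h2 h3 h4' h5 => hR (reducible_of_path_five hP h4 h1 h2 h3 h4' h5)
  have fresh : ∀ x y w, (x, y) ∈ P.gaps → w ∉ P.carrier → x ≠ w :=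
    fun x y w h hw hxw => hw (hxw ▸ h.1.1)
  have hba := gap_symm h2 hab
  have hcb := gap_symm h2 hbc
  have hdc := gap_symm h2 hcd
  have had := gap_symm h2 hda
  have hpairs := nodup_four_cycle_pairs hnd
  simp only [List.nodup_cons, List.mem_cons, List.not_mem_nil, or_false, not_or,
    not_false_eq_true, List.nodup_nil, and_true] at hnd
  obtain ⟨⟨nab, nac, nad⟩, ⟨nbc, nbd⟩, ncd⟩ := hnd
  have out : ∀ x y, (x, y) ∈ P.gaps → x ∉ [a, b, c, d] → y ∉ [a, b, c, d] := by
    intro x y hxy hx hy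
    simp only [List.mem_cons, List.not_mem_nil, or_false, not_or] at hx hy
    obtain ⟨nxa, nxb, nxc, nxd⟩ := hx
    rcases hy with rfl | rfl | rfl | rfl
    · refine path _ _ _ _ _ hxy hab hbc hcd ?_
      simp only [List.nodup_cons, List.mem_cons, List.not_mem_nil, or_false, not_or,
        not_false_eq_true, List.nodup_nil, and_true]
      and_intros <;> assumption
    · refine path _ _ _ _ _ hxy hbc hcd hda ?_
      simp only [List.nodup_cons, List.mem_cons, List.not_mem_nil, or_false, not_or,
        not_false_eq_true, List.nodup_nil, and_true]
      and_intros <;> first | assumption | exact Ne.symm ‹_›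
    · refine path _ _ _ _ _ hxy hcd hda hab ?_
      simp only [List.nodup_cons, List.mem_cons, List.not_mem_nil, or_false, not_or,
        not_false_eq_true, List.nodup_nil, and_true]
      and_intros <;> first | assumption | exact Ne.symm ‹_›
    · refine path _ _ _ _ _ hxy hda hab hbc ?_
      simp only [List.nodup_cons, List.mem_cons, List.not_mem_nil, or_false, not_or,
        not_false_eq_true, List.nodup_nil, and_true]
      and_intros <;> first | assumption | exact Ne.symm ‹_›
  obtain ⟨g, h, hgh, hS⟩ := exists_gap_notMem_list hP h4 _ hpairs (by simp) (by simp [*])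
  have ngh := gap_ne h2 hgh
  by_cases hg : g ∈ [a, b, c, d]
  · have hh : h ∈ [a, b, c, d] := by_contra fun hh => out h g (gap_symm h2 hgh) hh hg
    simp only [List.mem_cons, List.not_mem_nil, or_false] at hg hh
    rcases hg with rfl | rfl | rfl | rfl <;> rcases hh with rfl | rfl | rfl | rfl <;>
    first
    | exact ngh rfl
    | exact tri _ _ _ hab hbc hgh
    | exact tri _ _ _ hbc hcd hgh
    | exact tri _ _ _ hcd hda hgh
    | exact tri _ _ _ hda hab hgh
    | exact hS (by simp)
  have hh := out g h hgh hg
  have hhg := gap_symm h2 hgh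
  obtain ⟨k, hk, hhk⟩ := exists_gap_notMem hP h4 (h2 hgh).2 {g} (by simpa using hhg) rfl
  have nhk := gap_ne h2 hhk
  have hk' := out h k hhk hh
  simp only [Finset.mem_singleton] at hk
  simp only [List.mem_cons, List.not_mem_nil, or_false, not_or] at hg hh hk'
  obtain ⟨nga, ngb, ngc, ngd⟩ := hg
  obtain ⟨nha, nhb, nhc, nhd⟩ := hh
  obtain ⟨nka, nkb, nkc, nkd⟩ := hk'
  have hnd6 : [a, b, c, g, h, k].Nodup := by
    simp only [List.nodup_cons, List.mem_cons, List.not_mem_nil, or_false, not_or,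
      not_false_eq_true, List.nodup_nil, and_true]
    and_intros <;> first | assumption | exact Ne.symm ‹_›
  obtain ⟨Q, u, hQ, hext, hQ4, hle, hu, huP, hroof, hPQ⟩ := exists_roof hP h4
    (injective_of_nodup hnd6)
    (by
      intro i
      fin_cases i
      exacts [(h2 hab).1, (h2 hbc).1, (h2 hcd).1, (h2 hgh).1, (h2 hhk).1, (h2 hhk).2])
    {0, 1, 3, 4}
    (by
      simp only [Finset.mem_insert, Finset.mem_singleton, forall_eq_or_imp, forall_eq]
      exact ⟨hab, hbc, hgh, hhk⟩)
  have hcard : ({0, 1, 3, 4} : Finset (Fin 6)).card = 4 := by decide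
  have huc : (u 2, c) ∈ Q.gaps := gap_symm hQ4.2.2.2 (hroof 2 (by decide)).1
  have hau : (a, u 5) ∈ Q.gaps := gap_symm hQ4.2.2.2 (hroof 5 (by decide)).2
  have huk : (u 5, k) ∈ Q.gaps := gap_symm hQ4.2.2.2 (hroof 5 (by decide)).1
  have hcdQ : (c, d) ∈ Q.gaps := hPQ c d hcd (by
    simp [Ne.symm nac, Ne.symm nbc, Ne.symm nbd, Ne.symm ngc, Ne.symm nhc, Ne.symm nhd,
      Ne.symm nad, Ne.symm nkc])
  have hdaQ : (d, a) ∈ Q.gaps := hPQ d a hda (by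
    simp [Ne.symm nad, Ne.symm nbd, nab, nac, Ne.symm ngd, Ne.symm nga, Ne.symm nhd,
      Ne.symm nha, Ne.symm ncd])
  have hu25 : u 2 ≠ u 5 := fun h => absurd (hu h) (by decide)
  have hc2 := fresh _ _ _ hcd (huP 2)
  have hd2 := fresh _ _ _ hda (huP 2)
  have ha2 := fresh _ _ _ hab (huP 2)
  have hk2 := fresh _ _ _ (gap_symm h2 hhk) (huP 2)
  have hc5 := fresh _ _ _ hcd (huP 5)
  have hd5 := fresh _ _ _ hda (huP 5)
  have ha5 := fresh _ _ _ hab (huP 5)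
  have hk5 := fresh _ _ _ (gap_symm h2 hhk) (huP 5)
  refine hR (hext.reducible (by omega) (reducible_of_path_six hQ hQ4 huc hcdQ hdaQ hau huk ?_))
  simp only [List.nodup_cons, List.mem_cons, List.not_mem_nil, or_false, not_or,
    not_false_eq_true, List.nodup_nil, and_true]
  and_intros <;> first | assumption | exact Ne.symm ‹_›

theorem reducible_of_gaps_nonempty [Infinite α] (hP : P.carrier.Finite) (h4 : Cond4 P)
    (hne : P.gaps.Nonempty) : P.Reducible := by
  have h2 := h4.2.2.2
  obtain ⟨⟨b, c⟩, hbc⟩ := hne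
  have hcb := gap_symm h2 hbc
  obtain ⟨a, hac, hba⟩ := exists_gap_notMem hP h4 (h2 hbc).1 {c} (by simpa using hbc) rfl
  obtain ⟨d, hdb, hcd⟩ := exists_gap_notMem hP h4 (h2 hbc).2 {b} (by simpa using hcb) rfl
  have hdc := gap_symm h2 hcd
  obtain ⟨e, hec, hde⟩ := exists_gap_notMem hP h4 (h2 hcd).2 {c} (by simpa using hdc) rfl
  have hab := gap_symm h2 hba
  simp only [Finset.mem_singleton] at hac hdb hec
  have nab := gap_ne h2 hab
  have nbc := gap_ne h2 hbc
  have ncd := gap_ne h2 hcd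
  have nde := gap_ne h2 hde
  by_contra hR
  have nad : a ≠ d := by rintro rfl; exact hR (reducible_of_triangle hP h4 hab hbc hdc)
  have neb : e ≠ b := by
    rintro rfl
    exact hR (reducible_of_triangle hP h4 hbc hcd (gap_symm h2 hde))
  by_cases hea : e = a
  · subst e
    refine hR (reducible_of_four_cycle hP h4 hab hbc hcd hde ?_)
    simp only [List.nodup_cons, List.mem_cons, List.not_mem_nil, or_false, not_or,
      not_false_eq_true, List.nodup_nil, and_true]
    and_intros <;> first | assumption | exact Ne.symm ‹_›
  · refine hR (reducible_of_path_five hP h4 hab hbc hcd hde ?_)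
    simp only [List.nodup_cons, List.mem_cons, List.not_mem_nil, or_false, not_or,
      not_false_eq_true, List.nodup_nil, and_true]
    and_intros <;> first | assumption | exact Ne.symm ‹_›

end PartialIPLoop

/-- If `P` is a finite partial IP loop satisfying condition (4) with `Γ(P) ≠ ∅`,
then there is a finite partial IP loop `Q` extending `P`, satisfying condition (4)
as well, with strictly fewer gaps. -/
theorem exists_extension_fewer_gaps {α : Type*} [Infinite α]
    (P : PartialIPLoop α) (hP : P.carrier.Finite) (h4 : Cond4 P)
    (hne : P.gaps.Nonempty) :
    ∃ Q : PartialIPLoop α, Q.carrier.Finite ∧ P.Ext Q ∧ Cond4 Q ∧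
      Q.gaps.ncard < P.gaps.ncard := by
  exact PartialIPLoop.reducible_of_gaps_nonempty hP h4 hne
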